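/- arXiv:1407.5874 — 7 statements merged into one kernel-verified Lean document; each statement's English description precedes it below -/
import Mathlib

section
/- Let n ≥ 1, let P be a symmetric positive definite n×n real matrix, and let e : ℝⁿ → ℝ be Borel measurable with |e(x)| ≤ C·exp(c·‖x‖) for all x and some constants C, c > 0. Then the map m ↦ E_{N(m,P)}[e] is differentiable on ℝⁿ, and its gradient at any m ∈ ℝⁿ equals P⁻¹ · ∫_{ℝⁿ} e(x)(x − m) N(x|m,P) dx. -/
open MeasureTheory Matrix Real

/-- The multivariate Gaussian probability density `N(x | m, P)` on `ℝⁿ`. -/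
noncomputable def gaussDensity {n : ℕ} (m : Fin n → ℝ) (P : Matrix (Fin n) (Fin n) ℝ)
    (x : Fin n → ℝ) : ℝ :=
  (2 * π) ^ (-(n : ℝ) / 2) * P.det ^ (-(1 : ℝ) / 2) *
    Real.exp (-(1 / 2) * ((x - m) ⬝ᵥ (P⁻¹ *ᵥ (x - m))))

lemma aux_scalar (a c R : ℝ) (ha : 0 < a) :
    ∃ M : ℝ, 0 ≤ M ∧ ∀ t s : ℝ, 0 ≤ t → 0 ≤ s → t ≤ s + R → s ≤ t + R →
      Real.exp (c * t) * Real.exp (-(1 / 2) * (a * s ^ 2)) * (1 + s) ≤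
        M * Real.exp (-(a / 8) * t ^ 2) := by
  refine ⟨Real.exp (R + a * R ^ 2 / 2 + 2 * (c + 1) ^ 2 / a), (Real.exp_pos _).le, ?_⟩
  intro t s ht hs h1 h2
  have e1 : 1 + s ≤ Real.exp (t + R) := by
    have := Real.add_one_le_exp (t + R)
    linarith
  calc _ ≤ Real.exp (c * t) * Real.exp (-(1 / 2) * (a * s ^ 2)) * Real.exp (t + R) := by gcongr
    _ ≤ _ := by
      rw [← Real.exp_add, ← Real.exp_add, ← Real.exp_add]
      apply Real.exp_le_exp.2
      have q1 : t ^ 2 ≤ 2 * s ^ 2 + 2 * R ^ 2 := by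
        have : t ^ 2 ≤ (s + R) ^ 2 := by gcongr
        nlinarith [sq_nonneg (s - R)]
      have q2 : (c + 1) * t ≤ a / 8 * t ^ 2 + 2 * (c + 1) ^ 2 / a := by
        have : a / 8 * t ^ 2 + 2 * (c + 1) ^ 2 / a - (c + 1) * t
            = (a * t - 4 * (c + 1)) ^ 2 / (8 * a) := by
          field_simp
          ring
        have h3 : 0 ≤ (a * t - 4 * (c + 1)) ^ 2 / (8 * a) := by positivity
        linarith
      have q3 := mul_le_mul_of_nonneg_left q1 ha.le
      nlinarith

lemma aux_quad {n : ℕ} (hn : 1 ≤ n) (Q : Matrix (Fin n) (Fin n) ℝ) (hQ : Q.PosDef) :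
    ∃ a : ℝ, 0 < a ∧ ∀ v : Fin n → ℝ, a * ‖v‖ ^ 2 ≤ v ⬝ᵥ (Q *ᵥ v) := by
  have : Nonempty (Fin n) := ⟨⟨0, hn⟩⟩
  have hcont : Continuous fun v : Fin n → ℝ => v ⬝ᵥ (Q *ᵥ v) := by fun_prop
  have hne : (Metric.sphere (0 : Fin n → ℝ) 1).Nonempty :=
    NormedSpace.sphere_nonempty.2 zero_le_one
  obtain ⟨u, hu, hmin⟩ := (isCompact_sphere (0 : Fin n → ℝ) 1).exists_isMinOn hne
    hcont.continuousOn
  have hu1 : ‖u‖ = 1 := by simpa using hu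
  have hu0 : u ≠ 0 := by
    rintro rfl
    simp at hu1
  refine ⟨u ⬝ᵥ (Q *ᵥ u), by simpa using hQ.dotProduct_mulVec_pos hu0, fun v => ?_⟩
  by_cases hv : v = 0
  · simp [hv]
  have hv' : ‖v‖ ≠ 0 := norm_ne_zero_iff.2 hv
  have h1 : (‖v‖⁻¹ • v) ∈ Metric.sphere (0 : Fin n → ℝ) 1 := by
    simp [norm_smul, hv']
  have h2 := isMinOn_iff.1 hmin _ h1
  simp only [mulVec_smul, dotProduct_smul, smul_dotProduct, smul_eq_mul] at h2
  have h3 := mul_le_mul_of_nonneg_right h2 (sq_nonneg ‖v‖)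
  have h4 : ‖v‖⁻¹ * (‖v‖⁻¹ * (v ⬝ᵥ (Q *ᵥ v))) * ‖v‖ ^ 2 = v ⬝ᵥ (Q *ᵥ v) := by
    field_simp
  linarith

lemma aux_integrable {n : ℕ} (hn : 1 ≤ n) (b : ℝ) (hb : 0 < b) :
    Integrable fun x : Fin n → ℝ => Real.exp (-b * ‖x‖ ^ 2) := by
  have hn' : (0 : ℝ) < n := by exact_mod_cast hn
  have h1 : Integrable fun x : Fin n → ℝ => ∏ i, Real.exp (-(b / n) * (x i) ^ 2) :=
    Integrable.fintype_prod (f := fun _ : Fin n => fun y : ℝ => Real.exp (-(b / n) * y ^ 2))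
      (fun _ => integrable_exp_neg_mul_sq (by positivity))
  refine h1.mono' (by fun_prop) (Filter.Eventually.of_forall fun x => ?_)
  rw [← Real.exp_sum, Real.norm_eq_abs, abs_of_pos (Real.exp_pos _)]
  apply Real.exp_le_exp.2
  rw [← Finset.mul_sum]
  have h2 : ∑ i, (x i) ^ 2 ≤ n * ‖x‖ ^ 2 := by
    calc ∑ i, (x i) ^ 2 ≤ ∑ _i : Fin n, ‖x‖ ^ 2 := by
          apply Finset.sum_le_sum
          intro i _
          rw [← sq_abs]
          have := norm_le_pi_norm x i
          rw [Real.norm_eq_abs] at this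
          gcongr
      _ = _ := by simp
  have h3 : b / n * ∑ i, (x i) ^ 2 ≤ b / n * (n * ‖x‖ ^ 2) := by gcongr
  have h4 : b / n * (n * ‖x‖ ^ 2) = b * ‖x‖ ^ 2 := by field_simp
  linarith

lemma aux_bound {n : ℕ} (hn : 1 ≤ n)
    (P : Matrix (Fin n) (Fin n) ℝ) (hPpd : P.PosDef)
    (e : (Fin n → ℝ) → ℝ) (C c : ℝ) (hC : 0 < C)
    (hbound : ∀ x, |e x| ≤ C * Real.exp (c * ‖x‖)) (m₀ : Fin n → ℝ) :
    ∃ bd : (Fin n → ℝ) → ℝ, Integrable bd ∧ ∀ m ∈ Metric.ball m₀ 1, ∀ x,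
      |e x * gaussDensity m P x| * (1 + ‖x - m‖) ≤ bd x := by
  obtain ⟨a, ha, hq⟩ := aux_quad hn P⁻¹ hPpd.inv
  obtain ⟨M, hM, hs⟩ := aux_scalar a c (‖m₀‖ + 1) ha
  set K : ℝ := (2 * π) ^ (-(n : ℝ) / 2) * P.det ^ (-(1 : ℝ) / 2) with hK
  have hK0 : 0 ≤ K := by
    have := hPpd.det_pos
    positivity
  refine ⟨fun x => C * K * M * Real.exp (-(a / 8) * ‖x‖ ^ 2),
    (aux_integrable hn (a / 8) (by positivity)).const_mul _, fun m hm x => ?_⟩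
  have hm1 : ‖m‖ ≤ ‖m₀‖ + 1 := by
    have h1 : ‖m - m₀‖ < 1 := by simpa [dist_eq_norm] using hm
    have h2 := norm_le_norm_add_norm_sub' m m₀
    linarith
  have h1 : ‖x‖ ≤ ‖x - m‖ + (‖m₀‖ + 1) := by
    have h2 := norm_le_norm_add_norm_sub' x m
    linarith
  have h2 : ‖x - m‖ ≤ ‖x‖ + (‖m₀‖ + 1) := by
    have h2 := norm_sub_le x m
    linarith
  have key := hs ‖x‖ ‖x - m‖ (norm_nonneg _) (norm_nonneg _) h1 h2
  have hg : gaussDensity m P x ≤ K * Real.exp (-(1 / 2) * (a * ‖x - m‖ ^ 2)) := by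
    unfold gaussDensity
    rw [← hK]
    have := hq (x - m)
    gcongr _ * Real.exp ?_
    linarith
  have hg0 : 0 ≤ gaussDensity m P x := by
    unfold gaussDensity
    rw [← hK]
    positivity
  rw [abs_mul, abs_of_nonneg hg0]
  calc _ ≤ (C * Real.exp (c * ‖x‖)) * (K * Real.exp (-(1 / 2) * (a * ‖x - m‖ ^ 2)))
        * (1 + ‖x - m‖) := by
        gcongr
        exact hbound x
    _ = C * K * (Real.exp (c * ‖x‖) * Real.exp (-(1 / 2) * (a * ‖x - m‖ ^ 2))
        * (1 + ‖x - m‖)) := by ring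
    _ ≤ C * K * (M * Real.exp (-(a / 8) * ‖x‖ ^ 2)) := by gcongr
    _ = _ := by ring

/-- The bilinear form of a matrix as a continuous bilinear map. -/
noncomputable def auxB {n : ℕ} (Q : Matrix (Fin n) (Fin n) ℝ) :
    (Fin n → ℝ) →L[ℝ] (Fin n → ℝ) →L[ℝ] ℝ :=
  (Matrix.toLinearMap₂' ℝ Q).toContinuousBilinearMap

lemma auxB_apply {n : ℕ} (Q : Matrix (Fin n) (Fin n) ℝ) (v w : Fin n → ℝ) :
    auxB Q v w = v ⬝ᵥ (Q *ᵥ w) := by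
  simp [auxB, Matrix.toLinearMap₂'_apply']

lemma auxB_symm {n : ℕ} (Q : Matrix (Fin n) (Fin n) ℝ) (hQ : Q.IsSymm) (v w : Fin n → ℝ) :
    auxB Q v w = (Q *ᵥ v) ⬝ᵥ w := by
  rw [auxB_apply, dotProduct_mulVec, ← mulVec_transpose, hQ.eq]

lemma aux_deriv {n : ℕ} (P : Matrix (Fin n) (Fin n) ℝ) (hP : P⁻¹.IsSymm)
    (k : ℝ) (x m : Fin n → ℝ) :
    HasFDerivAt (fun m => k * gaussDensity m P x)
      ((k * gaussDensity m P x) • auxB P⁻¹ (x - m)) m := by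
  unfold gaussDensity
  simp only [← auxB_apply]
  have h0 : HasFDerivAt (fun m : Fin n → ℝ => x - m)
      (-(ContinuousLinearMap.id ℝ (Fin n → ℝ))) m := (hasFDerivAt_id m).const_sub x
  have h1 := (auxB P⁻¹).hasFDerivAt_of_bilinear h0 h0
  have h2 := (((h1.const_mul (-(1 / 2) : ℝ)).exp.const_mul
    ((2 * π) ^ (-(n : ℝ) / 2) * P.det ^ (-(1 : ℝ) / 2))).const_mul k)
  refine h2.congr_fderiv ?_
  ext1 h
  have hs : ∀ w, auxB P⁻¹ h w = auxB P⁻¹ w h := by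
    intro w
    rw [auxB_symm _ hP, auxB_apply, dotProduct_comm]
  simp
  rw [hs x, hs m]
  ring

lemma aux_cont {n : ℕ} (P : Matrix (Fin n) (Fin n) ℝ) (m : Fin n → ℝ) :
    Continuous fun x => gaussDensity m P x := by
  unfold gaussDensity
  fun_prop

/-- The map `m ↦ E_{N(m,P)}[e]` is differentiable and its gradient at `m` is
`P⁻¹ ∫ e(x)(x − m) N(x|m,P) dx`. -/
theorem stmt_0 {n : ℕ} (hn : 1 ≤ n)
    (P : Matrix (Fin n) (Fin n) ℝ) (hPsymm : P.IsSymm) (hPpd : P.PosDef)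
    (e : (Fin n → ℝ) → ℝ) (he : Measurable e)
    (C c : ℝ) (hC : 0 < C) (hc : 0 < c)
    (hbound : ∀ x, |e x| ≤ C * Real.exp (c * ‖x‖)) :
    Differentiable ℝ (fun m : Fin n → ℝ => ∫ x : Fin n → ℝ, e x * gaussDensity m P x) ∧
    ∀ m h : Fin n → ℝ,
      fderiv ℝ (fun m : Fin n → ℝ => ∫ x : Fin n → ℝ, e x * gaussDensity m P x) m h =
        (P⁻¹ *ᵥ (∫ x : Fin n → ℝ, (e x * gaussDensity m P x) • (x - m))) ⬝ᵥ h := by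
  have hQ : P⁻¹.IsSymm := by
    unfold Matrix.IsSymm
    rw [Matrix.transpose_nonsing_inv, hPsymm.eq]
  have main : ∀ m : Fin n → ℝ,
      HasFDerivAt (fun m : Fin n → ℝ => ∫ x : Fin n → ℝ, e x * gaussDensity m P x)
        (auxB P⁻¹ (∫ x : Fin n → ℝ, (e x * gaussDensity m P x) • (x - m))) m := by
    intro m
    obtain ⟨bd, hbd, hle⟩ := aux_bound hn P hPpd e C c hC hbound m
    have hmm : m ∈ Metric.ball m 1 := Metric.mem_ball_self one_pos
    have hmeas : ∀ m, AEStronglyMeasurable (fun x => e x * gaussDensity m P x) volume :=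
      fun m => (he.mul (aux_cont P m).measurable).aestronglyMeasurable
    have hint : Integrable fun x => (e x * gaussDensity m P x) • (x - m) := by
      refine hbd.mono' ((hmeas m).smul (by fun_prop)) (Filter.Eventually.of_forall fun x => ?_)
      refine le_trans ?_ (hle m hmm x)
      rw [norm_smul, Real.norm_eq_abs]
      gcongr
      linarith
    have hint0 : Integrable fun x => e x * gaussDensity m P x := by
      refine hbd.mono' (hmeas m) (Filter.Eventually.of_forall fun x => ?_)
      refine le_trans ?_ (hle m hmm x)
      rw [Real.norm_eq_abs]
      exact le_mul_of_one_le_right (abs_nonneg _) (by linarith [norm_nonneg (x - m)])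
    rw [← (auxB P⁻¹).integral_comp_comm hint]
    simp only [map_smul]
    refine hasFDerivAt_integral_of_dominated_of_fderiv_le
      (F' := fun m x => (e x * gaussDensity m P x) • auxB P⁻¹ (x - m))
      (bound := fun x => ‖auxB P⁻¹‖ * bd x)
      (Metric.ball_mem_nhds m one_pos) (Filter.Eventually.of_forall hmeas) hint0 ?_ ?_
      (hbd.const_mul _) ?_
    · exact (hmeas m).smul (by fun_prop)
    · refine Filter.Eventually.of_forall fun x m' hm' => ?_
      rw [norm_smul, Real.norm_eq_abs]
      calc _ ≤ |e x * gaussDensity m' P x| * (‖auxB P⁻¹‖ * (1 + ‖x - m'‖)) := by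
            gcongr
            refine ((auxB P⁻¹).le_opNorm _).trans ?_
            gcongr
            linarith
        _ = ‖auxB P⁻¹‖ * (|e x * gaussDensity m' P x| * (1 + ‖x - m'‖)) := by ring
        _ ≤ _ := by
            gcongr
            exact hle m' hm' x
    · exact Filter.Eventually.of_forall fun x m' _ => aux_deriv P hQ (e x) x m'
  refine ⟨fun m => (main m).differentiableAt, fun m h => ?_⟩
  rw [(main m).fderiv, auxB_symm _ hQ]
end

section
/- Let n ≥ 1, let m ∈ ℝⁿ, and let e : ℝⁿ → ℝ be Borel measurable with |e(x)| ≤ C·exp(c·‖x‖) for all x and some constants C, c > 0. Then the map P ↦ E_{N(m,P)}[e], defined on the open set of symmetric positive definite n×n matrices inside the space of symmetric matrices, is differentiable, and at every symmetric positive definite P its derivative in the direction of a symmetric matrix H equals tr(H·G) where G = (1/2) P⁻¹ (∫ e(x)(x−m)(x−m)ᵀ N(x|m,P) dx) P⁻¹ − (1/2) (∫ e(x) N(x|m,P) dx) P⁻¹. -/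
open MeasureTheory Matrix Real

attribute [local instance] Matrix.normedAddCommGroup Matrix.normedSpace

/-- The space of symmetric `n × n` real matrices, as a submodule of the matrices. -/
def symmMat (n : ℕ) : Submodule ℝ (Matrix (Fin n) (Fin n) ℝ) where
  carrier := {A | A.IsSymm}
  add_mem' := fun ha hb => ha.add hb
  zero_mem' := Matrix.isSymm_zero
  smul_mem' := fun k _ hA => hA.smul k

section helpers

/-- The uniform structure on matrices coming from the sup norm. -/
abbrev normUniform (n : ℕ) : UniformSpace (Matrix (Fin n) (Fin n) ℝ) :=
  (Matrix.normedAddCommGroup (m := Fin n) (n := Fin n)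
    (α := ℝ)).toMetricSpace.toPseudoMetricSpace.toUniformSpace

/-- The topology on matrices coming from the sup norm. -/
abbrev normTopology (n : ℕ) : TopologicalSpace (Matrix (Fin n) (Fin n) ℝ) :=
  (normUniform n).toTopologicalSpace

attribute [local instance] normUniform normTopology

variable {n : ℕ}

/-- The trace pairing `M ↦ (B ↦ tr (B M))`. -/
noncomputable def trPair (n : ℕ) : Matrix (Fin n) (Fin n) ℝ →L[ℝ] Matrix (Fin n) (Fin n) ℝ →L[ℝ] ℝ :=
  LinearMap.toContinuousLinearMap
    ((LinearMap.toContinuousLinearMap :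
        (Matrix (Fin n) (Fin n) ℝ →ₗ[ℝ] ℝ) ≃ₗ[ℝ] (Matrix (Fin n) (Fin n) ℝ →L[ℝ] ℝ)).toLinearMap ∘ₗ
      LinearMap.mk₂ ℝ (fun M B : Matrix (Fin n) (Fin n) ℝ => (B * M).trace)
        (by intros; simp [Matrix.mul_add])
        (by intros; simp)
        (by intros; simp [Matrix.add_mul])
        (by intros; simp))

theorem trPair_apply (M B : Matrix (Fin n) (Fin n) ℝ) : trPair n M B = (B * M).trace := rfl

theorem quad_eq (y : Fin n → ℝ) (B : Matrix (Fin n) (Fin n) ℝ) :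
    y ⬝ᵥ (B *ᵥ y) = trPair n (Matrix.vecMulVec y y) B := by
  rw [trPair_apply, Matrix.mul_vecMulVec, Matrix.trace_vecMulVec, dotProduct_comm]

theorem norm_vecMulVec_le (y : Fin n → ℝ) : ‖Matrix.vecMulVec y y‖ ≤ ‖y‖ ^ 2 := by
  rw [Matrix.norm_le_iff (by positivity)]
  intro i j
  rw [Matrix.vecMulVec_apply, norm_mul, sq]
  gcongr <;> exact norm_le_pi_norm y _

theorem exists_quad_lower {A : Matrix (Fin n) (Fin n) ℝ} (hA : A.PosDef) :
    ∃ d > 0, ∀ y : Fin n → ℝ, d * ‖y‖ ^ 2 ≤ y ⬝ᵥ (A *ᵥ y) := by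
  obtain ⟨d, hd, h⟩ := (isCompact_sphere (0 : Fin n → ℝ) 1).exists_forall_le'
    (f := fun y => y ⬝ᵥ (A *ᵥ y)) (a := 0)
    (Continuous.continuousOn (by fun_prop))
    (by
      intro y hy
      have : y ≠ 0 := by rintro rfl; simp at hy
      simpa using hA.dotProduct_mulVec_pos this)
  refine ⟨d, hd, fun y => ?_⟩
  by_cases hy : y = 0
  · simp [hy]
  have hn : ‖y‖ ≠ 0 := norm_ne_zero_iff.2 hy
  have := h (‖y‖⁻¹ • y) (by simp [norm_smul, hn])
  simp only [Matrix.mulVec_smul, dotProduct_smul, smul_dotProduct, smul_eq_mul] at this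
  calc d * ‖y‖ ^ 2 ≤ (‖y‖⁻¹ * (‖y‖⁻¹ * (y ⬝ᵥ A *ᵥ y))) * ‖y‖ ^ 2 := by gcongr
    _ = _ := by field_simp

theorem exists_quad_lower_nhds {A : Matrix (Fin n) (Fin n) ℝ} (hA : A.PosDef) :
    ∃ d > 0, ∃ s ∈ nhds A, ∀ B ∈ s, ∀ y : Fin n → ℝ, d * ‖y‖ ^ 2 ≤ y ⬝ᵥ (B *ᵥ y) := by
  obtain ⟨d, hd, h⟩ := exists_quad_lower hA
  refine ⟨d / 2, by positivity, Metric.ball A (d / 2 / (‖trPair n‖ + 1)),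
    Metric.ball_mem_nhds _ (by positivity), fun B hB y => ?_⟩
  have h1 : |y ⬝ᵥ ((B - A) *ᵥ y)| ≤ ‖trPair n‖ * ‖y‖ ^ 2 * ‖B - A‖ := by
    rw [quad_eq, ← Real.norm_eq_abs]
    refine (ContinuousLinearMap.le_opNorm _ _).trans ?_
    gcongr
    refine (ContinuousLinearMap.le_opNorm _ _).trans ?_
    gcongr
    exact norm_vecMulVec_le y
  rw [Metric.mem_ball, dist_eq_norm, lt_div_iff₀ (by positivity)] at hB
  have h2 : ‖trPair n‖ * ‖y‖ ^ 2 * ‖B - A‖ ≤ d / 2 * ‖y‖ ^ 2 := by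
    calc _ ≤ (‖B - A‖ * (‖trPair n‖ + 1)) * ‖y‖ ^ 2 := by
          nlinarith [mul_nonneg (norm_nonneg (B - A)) (sq_nonneg ‖y‖)]
      _ ≤ _ := by gcongr
  have h3 := (abs_le.1 (h1.trans h2)).1
  rw [Matrix.sub_mulVec, dotProduct_sub] at h3
  linarith [h y]

theorem integrable_aux (m : Fin n → ℝ) (a d : ℝ) (hd : 0 < d) :
    Integrable (fun x : Fin n → ℝ => Real.exp (a * ‖x - m‖ - d * ‖x - m‖ ^ 2)) := by
  suffices h : Integrable (fun x : Fin n → ℝ => Real.exp (a * ‖x‖ - d * ‖x‖ ^ 2)) from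
    h.comp_sub_right m
  have h0 : Integrable (fun x : Fin n → ℝ => Real.exp (- (d / 2 / (n + 1)) * ∑ i, x i ^ 2)) := by
    have := (GaussianFourier.integrable_cexp_neg_mul_sum_add (ι := Fin n)
      (b := ((d / 2 / (n + 1) : ℝ) : ℂ)) (by rw [Complex.ofReal_re]; positivity) 0).norm
    refine this.congr (Filter.Eventually.of_forall fun x => ?_)
    simp only [Pi.zero_apply, zero_mul, Finset.sum_const_zero, add_zero]
    rw [Complex.norm_exp]
    congr 1
    norm_cast
  refine (h0.const_mul (Real.exp (a ^ 2 / (2 * d)))).mono'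
    (Continuous.aestronglyMeasurable (by fun_prop)) (Filter.Eventually.of_forall fun x => ?_)
  rw [Real.norm_eq_abs, Real.abs_exp, ← Real.exp_add, Real.exp_le_exp]
  have h1 : a * ‖x‖ ≤ a ^ 2 / (2 * d) + d / 2 * ‖x‖ ^ 2 := by
    have : a ^ 2 / (2 * d) + d / 2 * ‖x‖ ^ 2 - a * ‖x‖ = (a - d * ‖x‖) ^ 2 / (2 * d) := by
      field_simp; ring
    have : 0 ≤ (a - d * ‖x‖) ^ 2 / (2 * d) := by positivity
    linarith
  have h2 : ∑ i, x i ^ 2 ≤ (n + 1) * ‖x‖ ^ 2 := by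
    calc ∑ i, x i ^ 2 ≤ ∑ i : Fin n, ‖x‖ ^ 2 := by
          refine Finset.sum_le_sum fun i _ => ?_
          rw [← sq_abs, ← Real.norm_eq_abs]
          gcongr
          exact norm_le_pi_norm x i
      _ ≤ _ := by simp; nlinarith [sq_nonneg ‖x‖]
  have h3 : d / 2 / (n + 1) * ∑ i, x i ^ 2 ≤ d / 2 * ‖x‖ ^ 2 := by
    calc _ ≤ d / 2 / (n + 1) * ((n + 1) * ‖x‖ ^ 2) := by gcongr
      _ = _ := by field_simp
  linarith

theorem hasFDerivAt_matInv (P : Matrix (Fin n) (Fin n) ℝ) (hP : IsUnit P) :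
    ∃ D : Matrix (Fin n) (Fin n) ℝ →L[ℝ] Matrix (Fin n) (Fin n) ℝ,
      HasFDerivAt (fun Q : Matrix (Fin n) (Fin n) ℝ => Q⁻¹) D P ∧
      ∀ H, D H = -(P⁻¹ * H * P⁻¹) := by
  obtain ⟨u, rfl⟩ := hP
  let : NormedRing (Matrix (Fin n) (Fin n) ℝ) := Matrix.linftyOpNormedRing
  let : NormedAlgebra ℝ (Matrix (Fin n) (Fin n) ℝ) := Matrix.linftyOpNormedAlgebra
  have hcs : CompleteSpace (Matrix (Fin n) (Fin n) ℝ) := FiniteDimensional.complete ℝ _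
  have h := hasFDerivAt_ringInverse (𝕜 := ℝ) u
  refine ⟨-ContinuousLinearMap.mulLeftRight ℝ (Matrix (Fin n) (Fin n) ℝ) ↑u⁻¹ ↑u⁻¹, ?_, ?_⟩
  · have e : (fun Q : Matrix (Fin n) (Fin n) ℝ => Q⁻¹) = Ring.inverse := by
      funext Q; exact Matrix.nonsing_inv_eq_ringInverse Q
    rw [e]
    exact h
  · intro H
    rw [← Matrix.coe_units_inv]
    rfl

theorem hasFDerivAt_det (P : Matrix (Fin n) (Fin n) ℝ) (hP : IsUnit P) :
    HasFDerivAt (fun Q : Matrix (Fin n) (Fin n) ℝ => Q.det) (P.det • trPair n P⁻¹) P := by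
  have hd : DifferentiableAt ℝ (fun Q : Matrix (Fin n) (Fin n) ℝ => Q.det) P := by
    simp only [Matrix.det_apply]
    have hent : ∀ i j, DifferentiableAt ℝ (fun Q : Matrix (Fin n) (Fin n) ℝ => Q i j) P :=
      fun i j => (LinearMap.toContinuousLinearMap
        (Matrix.entryLinearMap ℝ ℝ i j)).differentiableAt
    fun_prop
  convert hd.hasFDerivAt using 1
  ext1 H
  have hl : HasDerivAt (fun t : ℝ => P + t • H) H 0 := by
    have := ((hasDerivAt_id (0 : ℝ)).smul_const H).const_add P
    rw [one_smul] at this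
    exact this
  have h1 := HasFDerivAt.comp_hasDerivAt (f := fun t : ℝ => P + t • H) (0 : ℝ)
    (by simpa using hd.hasFDerivAt) hl
  have h2 : HasDerivAt (fun t : ℝ => (P + t • H).det) (P.det * (P⁻¹ * H).trace) 0 := by
    have h3 := ((Matrix.det (1 + (Polynomial.X : Polynomial ℝ) •
      (P⁻¹ * H).map Polynomial.C)).hasDerivAt 0).const_mul P.det
    rw [Matrix.derivative_det_one_add_X_smul] at h3
    refine h3.congr_of_eventuallyEq (Filter.Eventually.of_forall fun t => ?_)
    beta_reduce
    rw [← Polynomial.coe_evalRingHom, RingHom.map_det, ← Matrix.det_mul]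
    congr 1
    have : (Polynomial.evalRingHom t).mapMatrix (1 + (Polynomial.X : Polynomial ℝ) •
      (P⁻¹ * H).map Polynomial.C) = 1 + t • (P⁻¹ * H) := by
      generalize P⁻¹ * H = K
      ext i j
      simp [Matrix.one_apply, apply_ite]
      ring
    rw [this, mul_add, mul_one, Matrix.mul_smul, ← mul_assoc,
      Matrix.mul_nonsing_inv _ ((Matrix.isUnit_iff_isUnit_det _).1 hP), one_mul]
  have := h1.unique h2
  rw [this]
  simp [trPair_apply, Matrix.trace_mul_comm H]

theorem hasFDerivAt_G (m : Fin n → ℝ)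
    (e : (Fin n → ℝ) → ℝ) (he : Measurable e)
    (C c : ℝ) (hC : 0 < C) (hc : 0 < c)
    (hbound : ∀ x, |e x| ≤ C * Real.exp (c * ‖x‖))
    (A : Matrix (Fin n) (Fin n) ℝ) (hA : A.PosDef) :
    HasFDerivAt (fun B : Matrix (Fin n) (Fin n) ℝ =>
        ∫ x, e x * Real.exp (-(1 / 2) * ((x - m) ⬝ᵥ (B *ᵥ (x - m)))))
      (-(1 / 2 : ℝ) • trPair n (∫ x, (e x * Real.exp (-(1 / 2) * ((x - m) ⬝ᵥ (A *ᵥ (x - m))))) •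
        Matrix.vecMulVec (x - m) (x - m))) A := by
  obtain ⟨d, hd, s, hs, hq⟩ := exists_quad_lower_nhds hA
  -- basic bound
  have hb : ∀ B ∈ s, ∀ x, |e x * Real.exp (-(1 / 2) * ((x - m) ⬝ᵥ (B *ᵥ (x - m))))| ≤
      C * Real.exp (c * ‖m‖) * Real.exp (c * ‖x - m‖ - d / 2 * ‖x - m‖ ^ 2) := by
    intro B hB x
    rw [abs_mul, Real.abs_exp]
    calc _ ≤ C * Real.exp (c * ‖x‖) * Real.exp (-(1 / 2) * ((x - m) ⬝ᵥ (B *ᵥ (x - m)))) := by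
          gcongr; exact hbound x
      _ = C * Real.exp (c * ‖x‖ + -(1 / 2) * ((x - m) ⬝ᵥ (B *ᵥ (x - m)))) := by
          rw [mul_assoc, ← Real.exp_add]
      _ ≤ C * Real.exp (c * ‖m‖ + (c * ‖x - m‖ - d / 2 * ‖x - m‖ ^ 2)) := by
          have h1 := hq B hB (x - m)
          have h2 : ‖x‖ ≤ ‖x - m‖ + ‖m‖ := by simpa using norm_add_le (x - m) m
          have h3 := mul_le_mul_of_nonneg_left h2 hc.le
          refine mul_le_mul_of_nonneg_left (Real.exp_le_exp.2 ?_) hC.le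
          linarith
      _ = _ := by rw [Real.exp_add]; ring
  have hb2 : ∀ B ∈ s, ∀ x, ‖(e x * Real.exp (-(1 / 2) * ((x - m) ⬝ᵥ (B *ᵥ (x - m))))) •
      Matrix.vecMulVec (x - m) (x - m)‖ ≤
      2 * (C * Real.exp (c * ‖m‖)) * Real.exp ((c + 1) * ‖x - m‖ - d / 2 * ‖x - m‖ ^ 2) := by
    intro B hB x
    rw [norm_smul, Real.norm_eq_abs]
    have h1 : ‖Matrix.vecMulVec (x - m) (x - m)‖ ≤ 2 * Real.exp ‖x - m‖ := by
      have := Real.quadratic_le_exp_of_nonneg (norm_nonneg (x - m))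
      have := norm_vecMulVec_le (x - m)
      have := norm_nonneg (x - m)
      linarith
    calc _ ≤ (C * Real.exp (c * ‖m‖) * Real.exp (c * ‖x - m‖ - d / 2 * ‖x - m‖ ^ 2)) *
            (2 * Real.exp ‖x - m‖) := by
          gcongr; exact hb B hB x
      _ = 2 * (C * Real.exp (c * ‖m‖)) *
          (Real.exp (c * ‖x - m‖ - d / 2 * ‖x - m‖ ^ 2) * Real.exp ‖x - m‖) := by ring
      _ = _ := by rw [← Real.exp_add]; ring_nf
  have hmeas : ∀ B : Matrix (Fin n) (Fin n) ℝ, AEStronglyMeasurable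
      (fun x => e x * Real.exp (-(1 / 2) * ((x - m) ⬝ᵥ (B *ᵥ (x - m))))) := fun B =>
    he.aestronglyMeasurable.mul (Continuous.aestronglyMeasurable (by fun_prop))
  have hcv : Continuous fun x : Fin n → ℝ => Matrix.vecMulVec (x - m) (x - m) :=
    Continuous.matrix_vecMulVec (by fun_prop) (by fun_prop)
  have hmeas2 : ∀ B : Matrix (Fin n) (Fin n) ℝ, AEStronglyMeasurable
      (fun x => (e x * Real.exp (-(1 / 2) * ((x - m) ⬝ᵥ (B *ᵥ (x - m))))) •
        Matrix.vecMulVec (x - m) (x - m)) := fun B =>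
    (hmeas B).smul hcv.aestronglyMeasurable
  have hint2 : Integrable (fun x => (e x * Real.exp (-(1 / 2) * ((x - m) ⬝ᵥ (A *ᵥ (x - m))))) •
        Matrix.vecMulVec (x - m) (x - m)) :=
    ((integrable_aux m (c + 1) (d / 2) (by positivity)).const_mul _).mono' (hmeas2 A)
      (Filter.Eventually.of_forall (hb2 A (mem_of_mem_nhds hs)))
  have key := hasFDerivAt_integral_of_dominated_of_fderiv_le (μ := volume) (𝕜 := ℝ)
    (F := fun (B : Matrix (Fin n) (Fin n) ℝ) x =>
      e x * Real.exp (-(1 / 2) * ((x - m) ⬝ᵥ (B *ᵥ (x - m)))))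
    (F' := fun (B : Matrix (Fin n) (Fin n) ℝ) x => (-(1 / 2 : ℝ) • trPair n)
      ((e x * Real.exp (-(1 / 2) * ((x - m) ⬝ᵥ (B *ᵥ (x - m))))) •
        Matrix.vecMulVec (x - m) (x - m)))
    (bound := fun x => ‖-(1 / 2 : ℝ) • trPair n‖ * (2 * (C * Real.exp (c * ‖m‖)) *
      Real.exp ((c + 1) * ‖x - m‖ - d / 2 * ‖x - m‖ ^ 2)))
    hs (Filter.Eventually.of_forall hmeas)
    (((integrable_aux m c (d / 2) (by positivity)).const_mul _).mono' (hmeas A)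
      (Filter.Eventually.of_forall (hb A (mem_of_mem_nhds hs))))
    ((ContinuousLinearMap.continuous _).comp_aestronglyMeasurable (hmeas2 A))
    (Filter.Eventually.of_forall fun x B hB => by
      refine (ContinuousLinearMap.le_opNorm _ _).trans ?_
      gcongr
      exact hb2 B hB x)
    (((integrable_aux m (c + 1) (d / 2) (by positivity)).const_mul _).const_mul _)
    (Filter.Eventually.of_forall fun x B hB => by
      simp only [quad_eq]
      have := ((((trPair n (Matrix.vecMulVec (x - m) (x - m))).hasFDerivAt (x := B)).const_mul
        (-(1 / 2 : ℝ))).exp).const_mul (e x)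
      refine this.congr_fderiv ?_
      rw [_root_.smul_apply, map_smul]
      simp only [smul_smul]
      congr 1
      ring)
  rw [ContinuousLinearMap.integral_comp_comm _ hint2] at key
  exact key

/-- Differentiability of `P ↦ E_{N(m,P)}[e]` on the symmetric positive definite matrices
(inside the space of symmetric matrices), with derivative in the direction of a symmetric
matrix `H` equal to `tr (H • G)` where
`G = (1/2) P⁻¹ (∫ e(x)(x−m)(x−m)ᵀ N(x|m,P) dx) P⁻¹ − (1/2) (∫ e(x) N(x|m,P) dx) P⁻¹`. -/
theorem stmt_2_core {n : ℕ} (hn : 1 ≤ n) (m : Fin n → ℝ)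
    (e : (Fin n → ℝ) → ℝ) (he : Measurable e)
    (C c : ℝ) (hC : 0 < C) (hc : 0 < c)
    (hbound : ∀ x, |e x| ≤ C * Real.exp (c * ‖x‖)) :
    ∀ (P : Matrix (Fin n) (Fin n) ℝ) (hPsymm : P ∈ symmMat n) (hPpd : P.PosDef),
      ∃ L : (symmMat n) →L[ℝ] ℝ,
        HasFDerivAt
          (fun Q : symmMat n =>
            ∫ x : Fin n → ℝ, e x * gaussDensity m (Q : Matrix (Fin n) (Fin n) ℝ) x)
          L ⟨P, hPsymm⟩ ∧
        ∀ H : symmMat n,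
          L H = ((H : Matrix (Fin n) (Fin n) ℝ) *
            ((1 / 2 : ℝ) • (P⁻¹ *
                (∫ x : Fin n → ℝ,
                  (e x * gaussDensity m P x) • Matrix.vecMulVec (x - m) (x - m)) * P⁻¹) -
              ((1 / 2 : ℝ) * ∫ x : Fin n → ℝ, e x * gaussDensity m P x) • P⁻¹)).trace := by
  intro P hPsymm hPpd
  obtain ⟨D, hD, hDH⟩ := hasFDerivAt_matInv P hPpd.isUnit
  have hG := (hasFDerivAt_G m e he C c hC hc hbound P⁻¹ hPpd.inv).comp P hD
  have hdet := ((hasFDerivAt_det P hPpd.isUnit).rpow_const (p := -(1 : ℝ) / 2)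
    (Or.inl hPpd.det_pos.ne')).const_mul ((2 * π) ^ (-(n : ℝ) / 2))
  have hF := hdet.mul hG
  have hS := hF.comp (⟨P, hPsymm⟩ : symmMat n) ((symmMat n).subtypeL.hasFDerivAt)
  have hfac : ∀ Q : Matrix (Fin n) (Fin n) ℝ, ∫ x : Fin n → ℝ, e x * gaussDensity m Q x =
      (2 * π) ^ (-(n : ℝ) / 2) * Q.det ^ (-(1 : ℝ) / 2) *
        ∫ x, e x * Real.exp (-(1 / 2) * ((x - m) ⬝ᵥ (Q⁻¹ *ᵥ (x - m)))) := by
    intro Q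
    rw [← integral_const_mul]
    congr 1; funext x
    rw [gaussDensity]; ring
  have hfac2 : ∫ x : Fin n → ℝ, (e x * gaussDensity m P x) • Matrix.vecMulVec (x - m) (x - m) =
      ((2 * π) ^ (-(n : ℝ) / 2) * P.det ^ (-(1 : ℝ) / 2)) •
        ∫ x, (e x * Real.exp (-(1 / 2) * ((x - m) ⬝ᵥ (P⁻¹ *ᵥ (x - m))))) •
          Matrix.vecMulVec (x - m) (x - m) := by
    rw [← integral_smul]
    congr 1; funext x
    rw [smul_smul, gaussDensity]; congr 1; ring
  refine ⟨_, hS.congr_of_eventuallyEq (Filter.Eventually.of_forall fun Q => hfac Q), ?_⟩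
  intro H
  rw [hfac, hfac2]
  have hp : P.det ^ (-(1 : ℝ) / 2 - 1) * P.det = P.det ^ (-(1 : ℝ) / 2) := by
    rw [← Real.rpow_add_one hPpd.det_pos.ne']; congr 1; ring
  generalize (∫ x, (e x * Real.exp (-(1 / 2) * ((x - m) ⬝ᵥ (P⁻¹ *ᵥ (x - m))))) •
          Matrix.vecMulVec (x - m) (x - m)) = M
  have htr : (P⁻¹ * (H : Matrix (Fin n) (Fin n) ℝ) * P⁻¹ * M).trace =
      ((H : Matrix (Fin n) (Fin n) ℝ) * (P⁻¹ * M * P⁻¹)).trace := by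
    rw [mul_assoc, mul_assoc, Matrix.trace_mul_comm]
    simp only [mul_assoc]
  simp [hDH, trPair_apply, Matrix.mul_sub, htr]
  rw [← hp]
  ring

end helpers

theorem stmt_2 {n : ℕ} (hn : 1 ≤ n) (m : Fin n → ℝ)
    (e : (Fin n → ℝ) → ℝ) (he : Measurable e)
    (C c : ℝ) (hC : 0 < C) (hc : 0 < c)
    (hbound : ∀ x, |e x| ≤ C * Real.exp (c * ‖x‖)) :
    ∀ (P : Matrix (Fin n) (Fin n) ℝ) (hPsymm : P ∈ symmMat n) (hPpd : P.PosDef),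
      ∃ L : (symmMat n) →L[ℝ] ℝ,
        HasFDerivAt
          (fun Q : symmMat n =>
            ∫ x : Fin n → ℝ, e x * gaussDensity m (Q : Matrix (Fin n) (Fin n) ℝ) x)
          L ⟨P, hPsymm⟩ ∧
        ∀ H : symmMat n,
          L H = ((H : Matrix (Fin n) (Fin n) ℝ) *
            ((1 / 2 : ℝ) • (P⁻¹ *
                (∫ x : Fin n → ℝ,
                  (e x * gaussDensity m P x) • Matrix.vecMulVec (x - m) (x - m)) * P⁻¹) -
              ((1 / 2 : ℝ) * ∫ x : Fin n → ℝ, e x * gaussDensity m P x) • P⁻¹)).trace :=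
  stmt_2_core hn m e he C c hC hc hbound
end

section
/- Let n ≥ 1, let P be a symmetric positive definite n×n real matrix, let m ∈ ℝⁿ, and let f : ℝⁿ → ℝⁿ be continuously differentiable with ‖f(x)‖ ≤ C·exp(c·‖x‖) and ‖F_x(x)‖ ≤ C·exp(c·‖x‖) for all x and some constants C, c > 0, where F_x(x) denotes the Jacobian matrix of f at x. Then ∫_{ℝⁿ} f(x)(x−m)ᵀ N(x|m,P) dx = (∫_{ℝⁿ} F_x(x) N(x|m,P) dx)·P. -/
open MeasureTheory Matrix Real

attribute [local instance] Matrix.normedAddCommGroup Matrix.normedSpace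

lemma quad_lower {n : ℕ} (hn : 1 ≤ n) (Q : Matrix (Fin n) (Fin n) ℝ) (hQ : Q.PosDef) :
    ∃ δ > 0, ∀ y : Fin n → ℝ, δ * ‖y‖ ^ 2 ≤ y ⬝ᵥ (Q *ᵥ y) := by
  have : Nonempty (Fin n) := ⟨⟨0, hn⟩⟩
  have hcont : Continuous (fun y : Fin n → ℝ => y ⬝ᵥ (Q *ᵥ y)) := by fun_prop
  have hne : (Metric.sphere (0 : Fin n → ℝ) 1).Nonempty := NormedSpace.sphere_nonempty.2 zero_le_one
  obtain ⟨y0, hy0, hmin⟩ := (isCompact_sphere (0 : Fin n → ℝ) 1).exists_isMinOn hne hcont.continuousOn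
  have hy0' : y0 ≠ 0 := by
    rintro rfl
    simp at hy0
  refine ⟨y0 ⬝ᵥ (Q *ᵥ y0), by simpa using hQ.dotProduct_mulVec_pos hy0', fun y => ?_⟩
  by_cases hy : y = 0
  · simp [hy]
  have hpos : 0 < ‖y‖ := norm_pos_iff.2 hy
  have h1 : ‖y‖⁻¹ • y ∈ Metric.sphere (0 : Fin n → ℝ) 1 := by
    simp [norm_smul, hpos.ne']
  have h2 := isMinOn_iff.1 hmin _ h1
  simp only [Matrix.mulVec_smul, smul_dotProduct, dotProduct_smul, smul_eq_mul] at h2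
  calc _ ≤ (‖y‖⁻¹ * (‖y‖⁻¹ * (y ⬝ᵥ Q *ᵥ y))) * ‖y‖ ^ 2 := by gcongr
    _ = _ := by field_simp

lemma gauss_cont {n : ℕ} (m : Fin n → ℝ) (P : Matrix (Fin n) (Fin n) ℝ) :
    Continuous (gaussDensity m P) := by
  unfold gaussDensity
  fun_prop

lemma gauss_integrable {n : ℕ} (hn : 1 ≤ n)
    (P : Matrix (Fin n) (Fin n) ℝ) (hPpd : P.PosDef) (m : Fin n → ℝ)
    (h : (Fin n → ℝ) → ℝ) (hh : Continuous h) (A a : ℝ)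
    (hb : ∀ x, |h x| ≤ A * Real.exp (a * ‖x - m‖)) :
    Integrable (fun x => h x * gaussDensity m P x) := by
  obtain ⟨δ, hδ, hq⟩ := quad_lower hn P⁻¹ hPpd.inv
  have hn0 : (0 : ℝ) < n := by exact_mod_cast hn
  have hA : 0 ≤ A := by
    have := (abs_nonneg _).trans (hb m)
    simpa using this
  set K : ℝ := (2 * π) ^ (-(n : ℝ) / 2) * P.det ^ (-(1 : ℝ) / 2) with hK
  have hKpos : 0 ≤ K := by
    have := hPpd.det_pos
    positivity
  have hint0 : Integrable (fun y : Fin n → ℝ => ∏ i, Real.exp (-(δ / (4 * n)) * (y i) ^ 2)) :=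
    Integrable.fintype_prod (f := fun (_ : Fin n) (t : ℝ) => Real.exp (-(δ / (4 * n)) * t ^ 2))
      (fun _ => integrable_exp_neg_mul_sq (by positivity))
  have hint := ((hint0.comp_sub_right m).const_mul (A * K * Real.exp (a ^ 2 / δ)))
  refine hint.mono' (hh.mul (gauss_cont m P)).aestronglyMeasurable (Filter.Eventually.of_forall fun x => ?_)
  have hsum : ∑ i, ((x - m) i) ^ 2 ≤ n * ‖x - m‖ ^ 2 := by
    calc _ ≤ ∑ i : Fin n, ‖x - m‖ ^ 2 := by
          refine Finset.sum_le_sum fun i _ => ?_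
          rw [← sq_abs]
          have := norm_le_pi_norm (x - m) i
          rw [Real.norm_eq_abs] at this
          gcongr
      _ = _ := by simp
  have hg : gaussDensity m P x = K * Real.exp (-(1 / 2) * ((x - m) ⬝ᵥ (P⁻¹ *ᵥ (x - m)))) := rfl
  have hgpos : 0 ≤ gaussDensity m P x := by rw [hg]; positivity
  rw [Real.norm_eq_abs, abs_mul, abs_of_nonneg hgpos, ← Real.exp_sum, ← Finset.mul_sum]
  calc _ ≤ A * Real.exp (a * ‖x - m‖) * (K * Real.exp (-(1 / 2) * ((x - m) ⬝ᵥ (P⁻¹ *ᵥ (x - m))))) := by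
        rw [hg]
        gcongr
        exact hb x
    _ = A * K * Real.exp (a * ‖x - m‖ + -(1 / 2) * ((x - m) ⬝ᵥ (P⁻¹ *ᵥ (x - m)))) := by
        rw [Real.exp_add]; ring
    _ ≤ A * K * Real.exp (a ^ 2 / δ + -(δ / (4 * n)) * ∑ i, ((x - m) i) ^ 2) := by
        refine mul_le_mul_of_nonneg_left (Real.exp_le_exp.2 ?_) (by positivity)
        have h1 := hq (x - m)
        have h2 : δ / (4 * n) * ∑ i, ((x - m) i) ^ 2 ≤ δ / 4 * ‖x - m‖ ^ 2 := by
          calc _ ≤ δ / (4 * n) * (n * ‖x - m‖ ^ 2) := by gcongr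
            _ = _ := by field_simp
        have h3 : a * ‖x - m‖ ≤ a ^ 2 / δ + δ / 4 * ‖x - m‖ ^ 2 := by
          have : a ^ 2 / δ + δ / 4 * ‖x - m‖ ^ 2 - a * ‖x - m‖ = (a - δ / 2 * ‖x - m‖) ^ 2 / δ := by
            field_simp; ring
          have h4 : 0 ≤ (a - δ / 2 * ‖x - m‖) ^ 2 / δ := by positivity
          linarith
        linarith
    _ = _ := by rw [Real.exp_add]; simp only [Pi.sub_apply]; ring

lemma gauss_hasFDerivAt {n : ℕ} (P : Matrix (Fin n) (Fin n) ℝ) (hPsymm : P.IsSymm)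
    (hPpd : P.PosDef) (m x : Fin n → ℝ) (j : Fin n) :
    DifferentiableAt ℝ (gaussDensity m P) x ∧
    fderiv ℝ (gaussDensity m P) x (fun k => P k j) = -(gaussDensity m P x * (x - m) j) := by
  have hd : DifferentiableAt ℝ (gaussDensity m P) x := by
    unfold gaussDensity
    simp only [dotProduct, mulVec]
    fun_prop
  refine ⟨hd, ?_⟩
  set v : Fin n → ℝ := fun k => P k j with hv
  have hu : IsUnit P.det := hPpd.det_pos.ne'.isUnit
  have hPv : P⁻¹ *ᵥ v = Pi.single j 1 := by
    have : v = P *ᵥ Pi.single j 1 := by ext k; simp [hv]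
    rw [this, Matrix.mulVec_mulVec, Matrix.nonsing_inv_mul _ hu, Matrix.one_mulVec]
  have hsymm : ∀ w, v ⬝ᵥ (P⁻¹ *ᵥ w) = w j := by
    intro w
    have hi : (P⁻¹)ᵀ = P⁻¹ := by rw [Matrix.transpose_nonsing_inv, hPsymm.eq]
    rw [Matrix.dotProduct_mulVec, ← Matrix.mulVec_transpose, hi, hPv]
    simp
  have hline := hd.hasFDerivAt.hasLineDerivAt v
  have key : HasDerivAt (fun t : ℝ => gaussDensity m P (x + t • v))
      (-(gaussDensity m P x * (x - m) j)) 0 := by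
    have e : ∀ t : ℝ, gaussDensity m P (x + t • v) =
        (2 * π) ^ (-(n : ℝ) / 2) * P.det ^ (-(1 : ℝ) / 2) *
        Real.exp (-(1 / 2) * ((x - m) ⬝ᵥ (P⁻¹ *ᵥ (x - m)) + 2 * t * (x - m) j + t ^ 2 * v j)) := by
      intro t
      unfold gaussDensity
      have : x + t • v - m = (x - m) + t • v := by abel
      rw [this]
      simp only [Matrix.mulVec_add, Matrix.mulVec_smul, add_dotProduct, dotProduct_add,
        smul_dotProduct, dotProduct_smul, hsymm, hPv, smul_eq_mul, dotProduct_single,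
        Pi.add_apply, Pi.smul_apply]
      congr 2
      ring
    simp only [e]
    have hp : HasDerivAt (fun t : ℝ => -(1 / 2) * ((x - m) ⬝ᵥ (P⁻¹ *ᵥ (x - m)) + 2 * t * (x - m) j + t ^ 2 * v j))
        (-(x - m) j) 0 := by
      have h1 := ((((hasDerivAt_id (0 : ℝ)).const_mul 2).mul_const ((x - m) j)).const_add
        ((x - m) ⬝ᵥ (P⁻¹ *ᵥ (x - m)))).add (((hasDerivAt_id (0 : ℝ)).pow 2).mul_const (v j))
      have h2 := h1.const_mul (-(1 / 2))
      refine h2.congr_deriv ?_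
      simp
    refine ((hp.exp).const_mul _).congr_deriv ?_
    unfold gaussDensity
    simp
    ring
  exact hline.unique key

/-- Matrix-valued Gaussian integration-by-parts identity:
`∫ f(x)(x−m)ᵀ N(x|m,P) dx = (∫ F_x(x) N(x|m,P) dx)·P`, where `F_x(x)` is the Jacobian
matrix of `f` at `x`. -/
theorem stmt_5 {n : ℕ} (hn : 1 ≤ n)
    (P : Matrix (Fin n) (Fin n) ℝ) (hPsymm : P.IsSymm) (hPpd : P.PosDef)
    (m : Fin n → ℝ) (f : (Fin n → ℝ) → (Fin n → ℝ)) (hf : ContDiff ℝ 1 f)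
    (C c : ℝ) (hC : 0 < C) (hc : 0 < c)
    (hbound : ∀ x, ‖f x‖ ≤ C * Real.exp (c * ‖x‖))
    (hbound' : ∀ x, ‖fderiv ℝ f x‖ ≤ C * Real.exp (c * ‖x‖)) :
    (∫ x : Fin n → ℝ, gaussDensity m P x • Matrix.vecMulVec (f x) (x - m)) =
      (∫ x : Fin n → ℝ,
        gaussDensity m P x • LinearMap.toMatrix' (fderiv ℝ f x : _ →ₗ[ℝ] _)) * P := by
  have hfd : Differentiable ℝ f := hf.differentiable one_ne_zero
  have hfc : Continuous f := hf.continuous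
  have hf'c : Continuous (fderiv ℝ f) := hf.continuous_fderiv one_ne_zero
  have hexp : ∀ x : Fin n → ℝ, C * Real.exp (c * ‖x‖) ≤
      C * Real.exp (c * ‖m‖) * Real.exp (c * ‖x - m‖) := by
    intro x
    rw [mul_assoc, ← Real.exp_add]
    have : ‖x‖ ≤ ‖m‖ + ‖x - m‖ := by
      simpa using norm_add_le m (x - m)
    gcongr
    nlinarith
  have hcomp : ∀ i x, |f x i| ≤ C * Real.exp (c * ‖m‖) * Real.exp (c * ‖x - m‖) := fun i x =>
    (norm_le_pi_norm (f x) i).trans ((hbound x).trans (hexp x))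
  have hI1 : ∀ i, Integrable (fun x => f x i * gaussDensity m P x) := fun i =>
    gauss_integrable hn P hPpd m _ (by fun_prop) _ _ (hcomp i)
  have hI2 : ∀ i j, Integrable (fun x => (f x i * (x - m) j) * gaussDensity m P x) := fun i j =>
    gauss_integrable hn P hPpd m _ (by fun_prop) (C * Real.exp (c * ‖m‖)) (c + 1) (by
      intro x
      rw [abs_mul, add_mul, Real.exp_add, ← mul_assoc]
      have h1 : |(x - m) j| ≤ Real.exp (1 * ‖x - m‖) := by
        have h2 := norm_le_pi_norm (x - m) j
        have h3 := Real.add_one_le_exp ‖x - m‖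
        rw [Real.norm_eq_abs] at h2
        rw [one_mul]
        linarith
      have := hcomp i x
      gcongr)
  have hI3 : ∀ i v, Integrable (fun x => (fderiv ℝ f x v i) * gaussDensity m P x) := fun i v =>
    gauss_integrable hn P hPpd m _ (by fun_prop) (C * Real.exp (c * ‖m‖) * ‖v‖) c (by
      intro x
      calc |fderiv ℝ f x v i| ≤ ‖fderiv ℝ f x v‖ := norm_le_pi_norm (fderiv ℝ f x v) i
        _ ≤ ‖fderiv ℝ f x‖ * ‖v‖ := ContinuousLinearMap.le_opNorm _ _
        _ ≤ (C * Real.exp (c * ‖m‖) * Real.exp (c * ‖x - m‖)) * ‖v‖ := by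
          gcongr
          exact (hbound' x).trans (hexp x)
        _ = _ := by ring)
  have hentry : ∀ (G : (Fin n → ℝ) → Matrix (Fin n) (Fin n) ℝ),
      (∀ i j, Integrable (fun x => G x i j)) → ∀ i j, (∫ x, G x) i j = ∫ x, G x i j := by
    intro G hG i j
    have h1 := eval_integral (μ := volume) (f := fun x => (G x : Fin n → Fin n → ℝ))
      (fun i => Integrable.of_eval (hG i)) i
    have h2 := eval_integral (μ := volume) (f := fun x => G x i) (hG i) j
    exact (congrFun h1 j).trans h2
  have hL : ∀ i j, Integrable (fun x => (gaussDensity m P x • Matrix.vecMulVec (f x) (x - m)) i j) := by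
    intro i j
    refine (hI2 i j).congr (Filter.Eventually.of_forall fun x => ?_)
    simp [Matrix.vecMulVec_apply]
    ring
  have hR : ∀ i j, Integrable (fun x => (gaussDensity m P x •
      LinearMap.toMatrix' (fderiv ℝ f x : (Fin n → ℝ) →ₗ[ℝ] (Fin n → ℝ))) i j) := by
    intro i j
    refine (hI3 i (Pi.single j 1)).congr (Filter.Eventually.of_forall fun x => ?_)
    simp [LinearMap.toMatrix'_apply]
    ring
  ext i j
  rw [hentry _ hL, Matrix.mul_apply]
  simp_rw [hentry _ hR, ← integral_mul_const]
  rw [← integral_finsetSum _ (fun k _ => (hR i k).mul_const _)]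
  set v : Fin n → ℝ := fun k => P k j with hv
  have hfi : ∀ x, fderiv ℝ (fun y => f y i) x v = fderiv ℝ f x v i := by
    intro x
    have := (hasFDerivAt_pi'.1 (hfd x).hasFDerivAt i).fderiv
    rw [this]; rfl
  have hgi := fun x => gauss_hasFDerivAt P hPsymm hPpd m x j
  have ibp := integral_mul_fderiv_eq_neg_fderiv_mul_of_integrable (μ := volume)
    (f := fun y => f y i) (g := gaussDensity m P) (v := v)
    (by simpa only [hfi] using hI3 i v)
    (by
      refine (hI2 i j).neg.congr (Filter.Eventually.of_forall fun x => ?_)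
      simp only [Pi.neg_apply, hv, (hgi x).2]
      ring)
    (hI1 i) (fun x _ => (differentiableAt_pi.1 (hfd x)) i) (fun x _ => (hgi x).1)
  have e1 : ∀ x, (gaussDensity m P x • Matrix.vecMulVec (f x) (x - m)) i j =
      -(f x i * fderiv ℝ (gaussDensity m P) x v) := by
    intro x
    rw [hv, (hgi x).2]
    simp [Matrix.vecMulVec_apply]
    ring
  have e2 : ∀ x, ∑ k, (gaussDensity m P x •
      LinearMap.toMatrix' (fderiv ℝ f x : (Fin n → ℝ) →ₗ[ℝ] (Fin n → ℝ))) i k * P k j =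
      fderiv ℝ (fun y => f y i) x v * gaussDensity m P x := by
    intro x
    have h1 : fderiv ℝ f x v =
        LinearMap.toMatrix' (fderiv ℝ f x : (Fin n → ℝ) →ₗ[ℝ] (Fin n → ℝ)) *ᵥ v := by
      rw [LinearMap.toMatrix'_mulVec]; rfl
    rw [hfi, h1]
    simp only [Matrix.mulVec, dotProduct, Finset.sum_mul, Matrix.smul_apply, smul_eq_mul, hv]
    refine Finset.sum_congr rfl fun k _ => ?_
    ring
  simp_rw [e1, e2]
  rw [integral_neg, ibp, neg_neg]
end

section
/- Let n ≥ 1, let I ⊆ ℝ be an open interval, and let m_f, m_s : I → ℝⁿ be differentiable, P_f : I → (n×n real matrices) be differentiable with P_f(t) symmetric and invertible for all t ∈ I, and let f̄ : I → ℝⁿ, F̄ : I → (n×n matrices), Σ : I → (symmetric n×n matrices) be given. Assume for all t ∈ I: m_f'(t) = f̄(t), P_f'(t) = F̄(t)P_f(t) + P_f(t)F̄(t)ᵀ + Σ(t), and m_s'(t) = f̄(t) + (F̄(t)P_f(t) + Σ(t))·P_f(t)⁻¹·(m_s(t) − m_f(t)). Then the function λ(t) := −P_f(t)⁻¹(m_s(t)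 − m_f(t)) is differentiable on I and satisfies λ'(t) = −F̄(t)ᵀ λ(t) for all t ∈ I. -/
open MeasureTheory Matrix Real

attribute [local instance] Matrix.normedAddCommGroup Matrix.normedSpace

theorem ringInverse_aux {A : Type*} [NormedRing A] [NormedAlgebra ℝ A] [FiniteDimensional ℝ A]
    (P : ℝ → A) (P' : A) (t : ℝ) (hu : IsUnit (P t)) (h : HasDerivAt P P' t) :
    ∃ Q' : A, HasDerivAt (fun s => Ring.inverse (P s)) Q' t := by
  have : CompleteSpace A := FiniteDimensional.complete ℝ A
  obtain ⟨u, hu⟩ := hu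
  have h1 := hasFDerivAt_ringInverse (𝕜 := ℝ) u
  rw [hu] at h1
  exact ⟨_, h1.comp_hasDerivAt t h⟩

theorem inv_differentiableAt_aux {n : ℕ} (P : ℝ → Matrix (Fin n) (Fin n) ℝ)
    (P' : Matrix (Fin n) (Fin n) ℝ) (t : ℝ) (hu : IsUnit (P t)) (h : HasDerivAt P P' t) :
    ∃ Q' : Matrix (Fin n) (Fin n) ℝ, HasDerivAt (fun s => (P s)⁻¹) Q' t := by
  simp only [Matrix.nonsing_inv_eq_ringInverse]
  exact @ringInverse_aux (Matrix (Fin n) (Fin n) ℝ) Matrix.linftyOpNormedRing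
    Matrix.linftyOpNormedAlgebra (inferInstanceAs (FiniteDimensional ℝ (Matrix _ _ ℝ))) P P' t hu h

theorem mulVec_hasDerivAt_aux {n : ℕ} (P : ℝ → Matrix (Fin n) (Fin n) ℝ)
    (P' : Matrix (Fin n) (Fin n) ℝ) (v : ℝ → (Fin n → ℝ)) (v' : Fin n → ℝ) (t : ℝ)
    (h : HasDerivAt P P' t) (hv : HasDerivAt v v' t) :
    HasDerivAt (fun s => P s *ᵥ v s) (P' *ᵥ v t + P t *ᵥ v') t := by
  have h2 : ∀ i j, HasDerivAt (fun s => P s i j) (P' i j) t := fun i j =>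
    (hasDerivAt_pi.1 ((hasDerivAt_pi (φ := P) (φ' := P')).1 h i) j)
  have hv2 := hasDerivAt_pi.1 hv
  refine hasDerivAt_pi.2 fun i => ?_
  have := HasDerivAt.fun_sum (u := Finset.univ) fun j _ => (h2 i j).mul (hv2 j)
  simpa [Matrix.mulVec, dotProduct, Finset.sum_add_distrib] using this

/-- Change of variables of the type II Gaussian smoother (Appendix B): if the filtering
mean/covariance `m_f, P_f` and the smoothed mean `m_s` satisfy the stated ODEs on an open
interval, then `λ(t) = −P_f(t)⁻¹(m_s(t) − m_f(t))` satisfies `λ'(t) = −F̄(t)ᵀ λ(t)`. -/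
theorem stmt_7 {n : ℕ} (hn : 1 ≤ n) (t0 t1 : ℝ)
    (mf ms : ℝ → (Fin n → ℝ)) (Pf : ℝ → Matrix (Fin n) (Fin n) ℝ)
    (fbar : ℝ → (Fin n → ℝ)) (Fbar Sig : ℝ → Matrix (Fin n) (Fin n) ℝ)
    (hPfsymm : ∀ t ∈ Set.Ioo t0 t1, (Pf t).IsSymm)
    (hPfinv : ∀ t ∈ Set.Ioo t0 t1, IsUnit (Pf t))
    (hSigsymm : ∀ t ∈ Set.Ioo t0 t1, (Sig t).IsSymm)
    (hmf : ∀ t ∈ Set.Ioo t0 t1, HasDerivAt mf (fbar t) t)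
    (hPf : ∀ t ∈ Set.Ioo t0 t1,
      HasDerivAt Pf (Fbar t * Pf t + Pf t * (Fbar t)ᵀ + Sig t) t)
    (hms : ∀ t ∈ Set.Ioo t0 t1,
      HasDerivAt ms (fbar t + (Fbar t * Pf t + Sig t) *ᵥ ((Pf t)⁻¹ *ᵥ (ms t - mf t))) t) :
    ∀ t ∈ Set.Ioo t0 t1,
      HasDerivAt (fun s => -((Pf s)⁻¹ *ᵥ (ms s - mf s)))
        (-((Fbar t)ᵀ *ᵥ (-((Pf t)⁻¹ *ᵥ (ms t - mf t))))) t := by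
  intro t ht
  obtain ⟨Q', hQ⟩ := inv_differentiableAt_aux Pf _ t (hPfinv t ht) (hPf t ht)
  have hd := (hms t ht).sub (hmf t ht)
  have hmu := mulVec_hasDerivAt_aux _ _ _ _ t hQ hd
  have hprod := mulVec_hasDerivAt_aux _ _ _ _ t (hPf t ht) hmu
  have hdet : ∀ s ∈ Set.Ioo t0 t1, IsUnit (Pf s).det := fun s hs =>
    (Matrix.isUnit_iff_isUnit_det _).1 (hPfinv s hs)
  have heq : (fun s => Pf s *ᵥ ((Pf s)⁻¹ *ᵥ (ms - mf) s)) =ᶠ[nhds t] (ms - mf) := by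
    filter_upwards [isOpen_Ioo.mem_nhds ht] with s hs
    rw [Matrix.mulVec_mulVec, Matrix.mul_nonsing_inv _ (hdet s hs), Matrix.one_mulVec]
  have huniq := hprod.unique (hd.congr_of_eventuallyEq heq)
  refine hmu.neg.congr_deriv ?_
  generalize Q' *ᵥ (ms - mf) t + (Pf t)⁻¹ *ᵥ _ = w at huniq ⊢
  simp only [Pi.sub_apply] at huniq
  generalize (Pf t)⁻¹ *ᵥ (ms t - mf t) = m at huniq ⊢
  have h3 : Pf t *ᵥ w = Pf t *ᵥ (-((Fbar t)ᵀ *ᵥ m)) := by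
    rw [Matrix.mulVec_neg, Matrix.mulVec_mulVec]
    simp only [Matrix.add_mulVec] at huniq
    ext i
    have := congrFun huniq i
    simp only [Pi.add_apply, Pi.sub_apply, Pi.neg_apply] at this ⊢
    linarith
  have h4 := Matrix.mulVec_injective_of_isUnit (hPfinv t ht) h3
  rw [h4, Matrix.mulVec_neg]
end

section
/- Let n ≥ 1, let I ⊆ ℝ be an open interval, let P_f, P_s : I → (n×n real matrices) be differentiable with P_f(t), P_s(t) symmetric and invertible for all t ∈ I, and let F̄ : I → (n×n matrices), Σ : I → (symmetric n×n matrices) be given. Assume for all t ∈ I: P_f'(t) = F̄(t)P_f(t) + P_f(t)F̄(t)ᵀ + Σ(t) and P_s'(t) = (F̄(t)P_f(t) + Σ(t))P_f(t)⁻¹P_s(t) + P_s(t)P_f(t)⁻¹(P_f(t)F̄(t)ᵀ + Σ(t)) − Σ(t). Then Ψ(t) := −(1/2)(P_f(t)⁻¹ − P_s(t)⁻¹) is differentiable on I and satisfies Ψ'(t) = −Ψ(t)F̄(t) − F̄(t)ᵀΨ(t) + 2Ψ(t)Σ(t)Ψ(t) for all t ∈ I. -/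
open MeasureTheory Matrix Real

attribute [local instance] Matrix.normedAddCommGroup Matrix.normedSpace

theorem hasDerivAt_matrix_inv_aux {n : ℕ} (P : ℝ → Matrix (Fin n) (Fin n) ℝ)
    (D : Matrix (Fin n) (Fin n) ℝ) (t : ℝ) (hu : IsUnit (P t)) (h : HasDerivAt P D t) :
    HasDerivAt (fun s => (P s)⁻¹) (-((P t)⁻¹ * D * (P t)⁻¹)) t := by
  let : NormedRing (Matrix (Fin n) (Fin n) ℝ) := Matrix.linftyOpNormedRing
  let : NormedAlgebra ℝ (Matrix (Fin n) (Fin n) ℝ) := Matrix.linftyOpNormedAlgebra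
  have hc : @CompleteSpace (Matrix (Fin n) (Fin n) ℝ)
      (Matrix.linftyOpNormedRing (α := ℝ)).toMetricSpace.toPseudoMetricSpace.toUniformSpace :=
    FiniteDimensional.complete ℝ (Matrix (Fin n) (Fin n) ℝ)
  have hs : HasSummableGeomSeries (Matrix (Fin n) (Fin n) ℝ) :=
    @instHasSummableGeomSeriesOfCompleteSpace _ _ hc
  obtain ⟨u, hu⟩ := hu
  have h1 := hasFDerivAt_ringInverse (𝕜 := ℝ) u
  rw [hu] at h1
  have h2 := h1.comp_hasDerivAt t h
  have e : (↑u⁻¹ : Matrix (Fin n) (Fin n) ℝ) = (P t)⁻¹ := by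
    rw [← hu, Matrix.coe_units_inv]
  have e2 : (fun s => (P s)⁻¹) = Ring.inverse ∘ P := by
    funext s
    simp [Matrix.nonsing_inv_eq_ringInverse]
  rw [e2]
  rw [← e]
  exact h2

/-- Change of variables of the type II Gaussian smoother (Appendix B): if the filtering
and smoothing covariances `P_f, P_s` satisfy the stated ODEs on an open interval, then
`Ψ(t) = −(1/2)(P_f(t)⁻¹ − P_s(t)⁻¹)` satisfies
`Ψ'(t) = −Ψ(t)F̄(t) − F̄(t)ᵀΨ(t) + 2Ψ(t)Σ(t)Ψ(t)`. -/
theorem stmt_8 {n : ℕ} (hn : 1 ≤ n) (t0 t1 : ℝ)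
    (Pf Ps : ℝ → Matrix (Fin n) (Fin n) ℝ)
    (Fbar Sig : ℝ → Matrix (Fin n) (Fin n) ℝ)
    (hPfsymm : ∀ t ∈ Set.Ioo t0 t1, (Pf t).IsSymm)
    (hPssymm : ∀ t ∈ Set.Ioo t0 t1, (Ps t).IsSymm)
    (hPfinv : ∀ t ∈ Set.Ioo t0 t1, IsUnit (Pf t))
    (hPsinv : ∀ t ∈ Set.Ioo t0 t1, IsUnit (Ps t))
    (hSigsymm : ∀ t ∈ Set.Ioo t0 t1, (Sig t).IsSymm)
    (hPf : ∀ t ∈ Set.Ioo t0 t1,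
      HasDerivAt Pf (Fbar t * Pf t + Pf t * (Fbar t)ᵀ + Sig t) t)
    (hPs : ∀ t ∈ Set.Ioo t0 t1,
      HasDerivAt Ps ((Fbar t * Pf t + Sig t) * (Pf t)⁻¹ * Ps t +
        Ps t * (Pf t)⁻¹ * (Pf t * (Fbar t)ᵀ + Sig t) - Sig t) t) :
    ∀ t ∈ Set.Ioo t0 t1,
      HasDerivAt (fun s => -(1 / 2 : ℝ) • ((Pf s)⁻¹ - (Ps s)⁻¹))
        (-((-(1 / 2 : ℝ) • ((Pf t)⁻¹ - (Ps t)⁻¹)) * Fbar t) -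
          (Fbar t)ᵀ * (-(1 / 2 : ℝ) • ((Pf t)⁻¹ - (Ps t)⁻¹)) +
          (2 : ℝ) • ((-(1 / 2 : ℝ) • ((Pf t)⁻¹ - (Ps t)⁻¹)) * Sig t *
            (-(1 / 2 : ℝ) • ((Pf t)⁻¹ - (Ps t)⁻¹)))) t := by
  intro t ht
  have uf := (Matrix.isUnit_iff_isUnit_det _).1 (hPfinv t ht)
  have us := (Matrix.isUnit_iff_isUnit_det _).1 (hPsinv t ht)
  have h1 := hasDerivAt_matrix_inv_aux Pf _ t (hPfinv t ht) (hPf t ht)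
  have h2 := hasDerivAt_matrix_inv_aux Ps _ t (hPsinv t ht) (hPs t ht)
  have h3 := (h1.sub h2).const_smul (-(1 / 2 : ℝ))
  refine h3.congr_deriv ?_
  have f1 := Matrix.mul_nonsing_inv _ uf
  have f2 := Matrix.nonsing_inv_mul _ uf
  have s1 := Matrix.mul_nonsing_inv _ us
  have s2 := Matrix.nonsing_inv_mul _ us
  generalize (Pf t)⁻¹ = A at *
  generalize (Ps t)⁻¹ = B at *
  generalize Fbar t = F at *
  generalize (F)ᵀ = G at *
  generalize Sig t = S at *
  have E1 : A * (F * Pf t + Pf t * G + S) * A = A * F + G * A + A * S * A := by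
    calc _ = A * F * (Pf t * A) + (A * Pf t) * G * A + A * S * A := by noncomm_ring
      _ = _ := by rw [f1, f2]; noncomm_ring
  have E2 : B * ((F * Pf t + S) * A * Ps t + Ps t * A * (Pf t * G + S) - S) * B
      = B * F + B * S * A + G * B + A * S * B - B * S * B := by
    calc _ = B * F * (Pf t * A) * (Ps t * B) + B * S * A * (Ps t * B)
          + (B * Ps t) * (A * Pf t) * G * B + (B * Ps t) * A * S * B - B * S * B := by noncomm_ring
      _ = _ := by rw [f1, f2, s1, s2]; noncomm_ring
  rw [E1, E2]
  simp only [smul_mul_assoc, mul_smul_comm, mul_sub, sub_mul, mul_add, add_mul, smul_sub, smul_add, smul_neg]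
  module
end

section
/- Let n ≥ 1, let I ⊆ ℝ be an open interval, and suppose m_f, m_s : I → ℝⁿ and P_f, P_s : I → (n×n real matrices) are differentiable with P_f(t), P_s(t) symmetric invertible, and f̄ : I → ℝⁿ, F̄ : I → (n×n matrices), Σ : I → (symmetric n×n matrices) satisfy for all t: m_f'(t) = f̄(t), P_f'(t) = F̄(t)P_f(t) + P_f(t)F̄(t)ᵀ + Σ(t), m_s'(t) = f̄(t) + (F̄(t)P_f(t) + Σ(t))P_f(t)⁻¹(m_s(t) − m_f(t)), and P_s'(t) = (F̄(t)P_f(t) + Σ(t))P_f(t)⁻¹P_s(t) + P_s(t)P_f(t)⁻¹(P_f(t)F̄(t)ᵀ + Σ(t)) − Σ(t). Define λ(t) = −P_f(t)⁻¹(m_s(t) − m_f(t)), Ψ(t) = −(1/2)(P_f(t)⁻¹ − P_s(t)⁻¹), A(t) = −F̄(t) + 2Σ(t)Ψ(t), and b(t) = f̄(t) + F̄(t)(m_s(t) − m_f(t)) + A(t)m_s(t) − Σ(t)λ(t). Then for all t ∈ I: m_s'(t) = −A(t)m_s(t) + b(t) and P_s'(t) = −A(t)P_s(t) − P_s(t)A(t)ᵀ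 + Σ(t). -/
open MeasureTheory Matrix Real

attribute [local instance] Matrix.normedAddCommGroup Matrix.normedSpace

/-- The type II Gaussian smoothing solution satisfies the variational-form mean and
covariance ODEs `m_s' = −A m_s + b` and `P_s' = −A P_s − P_s Aᵀ + Σ`, where
`λ = −P_f⁻¹(m_s − m_f)`, `Ψ = −(1/2)(P_f⁻¹ − P_s⁻¹)`, `A = −F̄ + 2ΣΨ` and
`b = f̄ + F̄(m_s − m_f) + A m_s − Σλ`. -/
theorem stmt_9 {n : ℕ} (hn : 1 ≤ n) (t0 t1 : ℝ)
    (mf ms : ℝ → (Fin n → ℝ)) (Pf Ps : ℝ → Matrix (Fin n) (Fin n) ℝ)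
    (fbar : ℝ → (Fin n → ℝ)) (Fbar Sig : ℝ → Matrix (Fin n) (Fin n) ℝ)
    (hPfsymm : ∀ t ∈ Set.Ioo t0 t1, (Pf t).IsSymm)
    (hPssymm : ∀ t ∈ Set.Ioo t0 t1, (Ps t).IsSymm)
    (hPfinv : ∀ t ∈ Set.Ioo t0 t1, IsUnit (Pf t))
    (hPsinv : ∀ t ∈ Set.Ioo t0 t1, IsUnit (Ps t))
    (hSigsymm : ∀ t ∈ Set.Ioo t0 t1, (Sig t).IsSymm)
    (hmf : ∀ t ∈ Set.Ioo t0 t1, HasDerivAt mf (fbar t) t)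
    (hPf : ∀ t ∈ Set.Ioo t0 t1,
      HasDerivAt Pf (Fbar t * Pf t + Pf t * (Fbar t)ᵀ + Sig t) t)
    (hms : ∀ t ∈ Set.Ioo t0 t1,
      HasDerivAt ms (fbar t + (Fbar t * Pf t + Sig t) *ᵥ ((Pf t)⁻¹ *ᵥ (ms t - mf t))) t)
    (hPs : ∀ t ∈ Set.Ioo t0 t1,
      HasDerivAt Ps ((Fbar t * Pf t + Sig t) * (Pf t)⁻¹ * Ps t +
        Ps t * (Pf t)⁻¹ * (Pf t * (Fbar t)ᵀ + Sig t) - Sig t) t)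
    (lam : ℝ → (Fin n → ℝ)) (Psi A : ℝ → Matrix (Fin n) (Fin n) ℝ)
    (bv : ℝ → (Fin n → ℝ))
    (hlam : ∀ t, lam t = -((Pf t)⁻¹ *ᵥ (ms t - mf t)))
    (hPsi : ∀ t, Psi t = -(1 / 2 : ℝ) • ((Pf t)⁻¹ - (Ps t)⁻¹))
    (hA : ∀ t, A t = -Fbar t + (2 : ℝ) • (Sig t * Psi t))
    (hb : ∀ t, bv t = fbar t + Fbar t *ᵥ (ms t - mf t) + A t *ᵥ ms t - Sig t *ᵥ lam t) :
    ∀ t ∈ Set.Ioo t0 t1,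
      HasDerivAt ms (-(A t *ᵥ ms t) + bv t) t ∧
      HasDerivAt Ps (-(A t * Ps t) - Ps t * (A t)ᵀ + Sig t) t := by
  intro t ht
  have h1 : IsUnit (Pf t).det := (Matrix.isUnit_iff_isUnit_det _).1 (hPfinv t ht)
  have h2 : IsUnit (Ps t).det := (Matrix.isUnit_iff_isUnit_det _).1 (hPsinv t ht)
  have hA2 : A t = -Fbar t - Sig t * (Pf t)⁻¹ + Sig t * (Ps t)⁻¹ := by
    rw [hA, hPsi, Matrix.mul_smul, smul_smul, Matrix.mul_sub]
    norm_num
    abel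
  have hAT : (A t)ᵀ = -(Fbar t)ᵀ - (Pf t)⁻¹ * Sig t + (Ps t)⁻¹ * Sig t := by
    rw [hA2]
    simp only [Matrix.transpose_add, Matrix.transpose_sub, Matrix.transpose_neg,
      Matrix.transpose_mul, Matrix.transpose_nonsing_inv, (hPfsymm t ht).eq,
      (hPssymm t ht).eq, (hSigsymm t ht).eq]
  constructor
  · convert hms t ht using 1
    rw [hb, hlam, Matrix.mulVec_neg, Matrix.add_mulVec, Matrix.mulVec_mulVec _ (Fbar t * Pf t),
      Matrix.mul_nonsing_inv_cancel_right _ _ h1]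
    abel
  · convert hPs t ht using 1
    have e1 : A t * Ps t = -(Fbar t * Ps t) - Sig t * (Pf t)⁻¹ * Ps t + Sig t := by
      rw [hA2, Matrix.add_mul, Matrix.sub_mul, Matrix.neg_mul,
        Matrix.nonsing_inv_mul_cancel_right _ _ h2]
    have e2 : Ps t * (A t)ᵀ = -(Ps t * (Fbar t)ᵀ) - Ps t * (Pf t)⁻¹ * Sig t + Sig t := by
      rw [hAT, Matrix.mul_add, Matrix.mul_sub, Matrix.mul_neg,
        Matrix.mul_nonsing_inv_cancel_left _ _ h2, Matrix.mul_assoc]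
    rw [e1, e2, Matrix.add_mul, Matrix.mul_nonsing_inv_cancel_right _ _ h1, Matrix.add_mul,
      Matrix.mul_add, Matrix.mul_assoc (Ps t) _ (Pf t * _),
      Matrix.nonsing_inv_mul_cancel_left _ _ h1]
    abel
end

section
/- Let n ≥ 1, let Σ be a symmetric positive definite n×n real matrix, Ψ a symmetric n×n real matrix, λ, m₀ ∈ ℝⁿ, and define e(x) = (1/2)(Σλ + 2ΣΨ(x − m₀))ᵀ Σ⁻¹ (Σλ + 2ΣΨ(x − m₀)) for x ∈ ℝⁿ. Then for every symmetric positive definite n×n matrix P: (i) the gradient of the map m ↦ E_{N(m,P)}[e] evaluated at m = m₀ equals 2ΨΣλ; (ii) for every m ∈ ℝⁿ, the derivative of the map P ↦ E_{N(m,P)}[e] in the direction of a symmetric matrix D equals tr((2ΨΣΨ)·D), i.e. ∇_P E_{N(m,P)}[e] = 2ΨΣΨ. -/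
open MeasureTheory Matrix Real

attribute [local instance] Matrix.normedAddCommGroup Matrix.normedSpace

open ProbabilityTheory

lemma w_int_all (a : ℕ) : Integrable (fun t : ℝ => t ^ a * gaussianPDFReal 0 1 t) := by
  have h : Integrable (fun t : ℝ => t ^ a) (gaussianReal 0 1) := by
    have := (memLp_id_gaussianReal (μ := 0) (v := 1) (a : NNReal))
    rcases Nat.eq_zero_or_pos a with rfl | ha
    · simp
    · have h2 := this.integrable_norm_rpow (by simp; omega) (by simp)
      refine h2.mono' (by fun_prop) (ae_of_all _ fun t => ?_)
      simp
  rw [gaussianReal_of_var_ne_zero _ one_ne_zero,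
    integrable_withDensity_iff_integrable_smul' (by fun_prop) (by simp [gaussianPDF])] at h
  refine h.congr (ae_of_all _ fun t => ?_)
  simp [mul_comm]

lemma w_zero : ∫ t : ℝ, t ^ 0 * gaussianPDFReal 0 1 t = 1 := by
  simp [integral_gaussianPDFReal_eq_one]

lemma w_one : ∫ t : ℝ, t ^ 1 * gaussianPDFReal 0 1 t = 0 := by
  have := integral_gaussianReal_eq_integral_smul (μ := 0) (v := 1) (f := fun x : ℝ => x) one_ne_zero
  rw [integral_id_gaussianReal] at this
  simpa [mul_comm] using this.symm

lemma w_two : ∫ t : ℝ, t ^ 2 * gaussianPDFReal 0 1 t = 1 := by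
  have := integral_gaussianReal_eq_integral_smul (μ := 0) (v := 1) (f := fun x : ℝ => x ^ 2) one_ne_zero
  have h2 := variance_fun_id_gaussianReal (μ := 0) (v := 1)
  rw [variance_eq_integral measurable_id'.aemeasurable] at h2
  simp only [integral_id_gaussianReal, sub_zero] at h2
  rw [h2] at this
  simpa [mul_comm] using this.symm

/-- product of standard normal densities -/
noncomputable def phiStd {n : ℕ} (z : Fin n → ℝ) : ℝ := ∏ k, gaussianPDFReal 0 1 (z k)

lemma mono_eq {n : ℕ} (a : Fin n → ℕ) (z : Fin n → ℝ) :
    (∏ k, z k ^ a k) * phiStd z = ∏ k, (z k ^ a k * gaussianPDFReal 0 1 (z k)) := by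
  rw [phiStd, Finset.prod_mul_distrib]

lemma mono_int {n : ℕ} (a : Fin n → ℕ) :
    Integrable (fun z : Fin n → ℝ => (∏ k, z k ^ a k) * phiStd z) := by
  simp_rw [mono_eq]
  exact Integrable.fintype_prod (f := fun k t => t ^ a k * gaussianPDFReal 0 1 t)
    (fun i => w_int_all _)

lemma mono_val {n : ℕ} (a : Fin n → ℕ) :
    ∫ z : Fin n → ℝ, (∏ k, z k ^ a k) * phiStd z =
      ∏ k, ∫ t : ℝ, t ^ a k * gaussianPDFReal 0 1 t := by
  simp_rw [mono_eq]
  exact integral_fintype_prod_volume_eq_prod (fun k t => t ^ a k * gaussianPDFReal 0 1 t)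

lemma p1 {n : ℕ} (i : Fin n) (z : Fin n → ℝ) : ∏ k, z k ^ (if k = i then 1 else 0) = z i := by
  rw [Finset.prod_eq_single i] <;> simp +contextual
lemma p2 {n : ℕ} (i j : Fin n) (z : Fin n → ℝ) :
    ∏ k, z k ^ ((if k = i then 1 else 0) + (if k = j then 1 else 0)) = z i * z j := by
  simp_rw [pow_add, Finset.prod_mul_distrib, p1]

lemma m0int {n : ℕ} : Integrable (fun z : Fin n → ℝ => phiStd z) := by
  simpa using mono_int (n := n) (fun _ => 0)
lemma m0val {n : ℕ} : ∫ z : Fin n → ℝ, phiStd z = 1 := by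
  have := mono_val (n := n) (fun _ => 0)
  simp only [w_zero] at this
  simpa using this
lemma m1int {n : ℕ} (i : Fin n) : Integrable (fun z : Fin n → ℝ => z i * phiStd z) := by
  simpa only [p1] using mono_int (n := n) (fun k => if k = i then 1 else 0)
lemma m1val {n : ℕ} (i : Fin n) : ∫ z : Fin n → ℝ, z i * phiStd z = 0 := by
  have := mono_val (n := n) (fun k => if k = i then 1 else 0)
  simp only [p1] at this
  rw [this]
  apply Finset.prod_eq_zero (Finset.mem_univ i)
  simpa using w_one
lemma m2int {n : ℕ} (i j : Fin n) : Integrable (fun z : Fin n → ℝ => z i * z j * phiStd z) := by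
  simpa only [p2] using
    mono_int (n := n) (fun k => (if k = i then 1 else 0) + (if k = j then 1 else 0))
lemma m2val {n : ℕ} (i j : Fin n) :
    ∫ z : Fin n → ℝ, z i * z j * phiStd z = if i = j then 1 else 0 := by
  have := mono_val (n := n) (fun k => (if k = i then 1 else 0) + (if k = j then 1 else 0))
  simp only [p2] at this
  rw [this]
  split_ifs with h
  · subst h
    apply Finset.prod_eq_one
    intro k _
    by_cases hk : k = i
    · simpa [hk] using w_two
    · simpa [hk] using w_zero
  · apply Finset.prod_eq_zero (Finset.mem_univ i)
    simpa [h] using w_one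

lemma quad_val {n : ℕ} (c : ℝ) (u : Fin n → ℝ) (K : Matrix (Fin n) (Fin n) ℝ) :
    ∫ z : Fin n → ℝ, (c + u ⬝ᵥ z + z ⬝ᵥ (K *ᵥ z)) * phiStd z = c + K.trace := by
  have e : ∀ z : Fin n → ℝ, (c + u ⬝ᵥ z + z ⬝ᵥ (K *ᵥ z)) * phiStd z =
      c * phiStd z + ∑ i, u i * (z i * phiStd z) +
        ∑ i, ∑ j, K i j * (z i * z j * phiStd z) := by
    intro z
    simp only [dotProduct, mulVec, add_mul, Finset.sum_mul, Finset.mul_sum]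
    congr 1
    · congr 1
      exact Finset.sum_congr rfl fun i _ => by ring
    · exact Finset.sum_congr rfl fun i _ => Finset.sum_congr rfl fun j _ => by ring
  simp_rw [e]
  have i0 : Integrable (fun z : Fin n → ℝ => c * phiStd z) := m0int.const_mul c
  have i1 : Integrable (fun z : Fin n → ℝ => ∑ i, u i * (z i * phiStd z)) :=
    integrable_finsetSum _ fun i _ => (m1int i).const_mul _
  have i2' : ∀ i, Integrable (fun z : Fin n → ℝ => ∑ j, K i j * (z i * z j * phiStd z)) :=
    fun i => integrable_finsetSum _ fun j _ => (m2int i j).const_mul _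
  have i01 : Integrable (fun z : Fin n → ℝ => c * phiStd z + ∑ i, u i * (z i * phiStd z)) :=
    i0.add i1
  have i2 : Integrable (fun z : Fin n → ℝ => ∑ i, ∑ j, K i j * (z i * z j * phiStd z)) :=
    integrable_finsetSum _ fun i _ => i2' i
  rw [integral_add i01 i2, integral_add i0 i1,
    integral_finsetSum _ fun i _ => (m1int i).const_mul _, integral_finsetSum _ fun i _ => i2' i]
  have : ∀ i, ∫ z : Fin n → ℝ, ∑ j, K i j * (z i * z j * phiStd z) = K i i := by
    intro i
    rw [integral_finsetSum _ fun j _ => (m2int i j).const_mul _]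
    simp [integral_const_mul, m2val]
  simp [this, integral_const_mul, m0val, m1val, trace]

lemma phi_eq {n : ℕ} (z : Fin n → ℝ) :
    phiStd z = (2 * π) ^ (-(n : ℝ) / 2) * Real.exp (-(1 / 2) * (z ⬝ᵥ z)) := by
  simp only [phiStd, gaussianPDFReal, Finset.prod_mul_distrib, ← Real.exp_sum]
  congr 1
  · simp only [NNReal.coe_one, mul_one, Finset.prod_const, Finset.card_univ, Fintype.card_fin]
    rw [Real.sqrt_eq_rpow, ← Real.rpow_neg (by positivity), ← Real.rpow_mul_natCast (by positivity)]
    congr 1; ring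
  · congr 1
    simp only [dotProduct, Finset.mul_sum]
    exact Finset.sum_congr rfl fun i _ => by simp; ring

lemma factor {n : ℕ} {P : Matrix (Fin n) (Fin n) ℝ} (hP : P.PosDef) :
    ∃ B : Matrix (Fin n) (Fin n) ℝ, P = B * Bᵀ ∧ B.det ≠ 0 := by
  open scoped MatrixOrder Matrix.Norms.L2Operator in
  obtain ⟨C, hC⟩ := CStarAlgebra.nonneg_iff_eq_star_mul_self.mp hP.posSemidef.nonneg
  have h : P = Cᵀ * Cᵀᵀ := by simpa [star_eq_conjTranspose] using hC
  refine ⟨Cᵀ, h, fun h0 => ?_⟩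
  have := hP.det_pos
  rw [h, det_mul, h0] at this
  simp at this

lemma posDef_ev {n : ℕ} {P : Matrix (Fin n) (Fin n) ℝ} (hP : P.PosDef) :
    ∀ᶠ Q in nhds P, Q.IsSymm → Q.PosDef := by
  have h := (isCompact_sphere (0 : Fin n → ℝ) 1).eventually_forall_of_forall_eventually
    (x₀ := P) (P := fun (Q : Matrix (Fin n) (Fin n) ℝ) (y : Fin n → ℝ) => 0 < y ⬝ᵥ (Q *ᵥ y)) (by
      intro y hy
      have hc : Continuous fun z : Matrix (Fin n) (Fin n) ℝ × (Fin n → ℝ) =>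
        z.2 ⬝ᵥ (z.1 *ᵥ z.2) := by fun_prop
      refine hc.continuousAt.eventually (lt_mem_nhds ?_)
      have : y ≠ 0 := by rintro rfl; simp at hy
      simpa using hP.dotProduct_mulVec_pos this)
  filter_upwards [h] with Q hQ hs
  refine PosDef.of_dotProduct_mulVec_pos (by simpa [IsHermitian, IsSymm] using hs) fun x hx => ?_
  have hn : 0 < ‖x‖ := norm_pos_iff.mpr hx
  have := hQ (‖x‖⁻¹ • x) (by simp [norm_smul, hn.ne'])
  simp only [mulVec_smul, dotProduct_smul, smul_dotProduct, smul_eq_mul] at this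
  have h3 := (mul_pos_iff_of_pos_left (inv_pos.mpr hn)).mp this
  simpa using (mul_pos_iff_of_pos_left (inv_pos.mpr hn)).mp h3


lemma quadForm_eq {n : ℕ} {P B : Matrix (Fin n) (Fin n) ℝ} (h : P = B * Bᵀ) (hB : B.det ≠ 0)
    (z : Fin n → ℝ) : (B *ᵥ z) ⬝ᵥ (P⁻¹ *ᵥ (B *ᵥ z)) = z ⬝ᵥ z := by
  have hu : IsUnit B.det := isUnit_iff_ne_zero.mpr hB
  have hut : IsUnit Bᵀ.det := by rwa [det_transpose]
  have h1 : Bᵀ * P⁻¹ * B = 1 := by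
    rw [h, Matrix.mul_inv_rev, ← Matrix.mul_assoc, Matrix.mul_nonsing_inv _ hut, Matrix.one_mul,
      Matrix.nonsing_inv_mul _ hu]
  rw [dotProduct_comm, ← dotProduct_transpose_mulVec]
  simp [mulVec_mulVec, ← Matrix.mul_assoc, h1]

lemma gauss_val {n : ℕ} {P : Matrix (Fin n) (Fin n) ℝ} (hP : P.PosDef) (m : Fin n → ℝ)
    (c : ℝ) (u : Fin n → ℝ) (K : Matrix (Fin n) (Fin n) ℝ) :
    ∫ x : Fin n → ℝ, (c + u ⬝ᵥ (x - m) + (x - m) ⬝ᵥ (K *ᵥ (x - m))) * gaussDensity m P x =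
      c + (K * P).trace := by
  obtain ⟨B, hPB, hB⟩ := factor hP
  let g : (Fin n → ℝ) → ℝ := fun y => (c + u ⬝ᵥ y + y ⬝ᵥ (K *ᵥ y)) *
    ((2 * π) ^ (-(n : ℝ) / 2) * P.det ^ (-(1 : ℝ) / 2) *
      Real.exp (-(1 / 2) * (y ⬝ᵥ (P⁻¹ *ᵥ y))))
  have hg : Continuous g := by
    have : Continuous fun y : Fin n → ℝ => y ⬝ᵥ (P⁻¹ *ᵥ y) := by fun_prop
    have : Continuous fun y : Fin n → ℝ => y ⬝ᵥ (K *ᵥ y) := by fun_prop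
    have : Continuous fun y : Fin n → ℝ => u ⬝ᵥ y := by fun_prop
    fun_prop
  have h1 : ∫ x : Fin n → ℝ, (c + u ⬝ᵥ (x - m) + (x - m) ⬝ᵥ (K *ᵥ (x - m))) * gaussDensity m P x =
      ∫ y, g y := integral_sub_right_eq_self g m
  have h2 : ∫ z, g (B *ᵥ z) = |B.det|⁻¹ * ∫ y, g y := by
    have hm : AEMeasurable (fun z => toLin' B z) (volume : Measure (Fin n → ℝ)) :=
      (LinearMap.continuous_of_finiteDimensional (toLin' B)).aemeasurable
    have := integral_map hm (f := g) hg.aestronglyMeasurable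
    have h3 := Real.map_matrix_volume_pi_eq_smul_volume_pi hB
    rw [show (fun z => toLin' B z) = ⇑(toLin' B) from rfl, h3, integral_smul_measure] at this
    rw [ENNReal.toReal_ofReal (abs_nonneg _), abs_inv, smul_eq_mul] at this
    rw [this]
    simp [toLin'_apply]
  have hpos : 0 < |B.det| := abs_pos.mpr hB
  have hdet : P.det ^ (-(1 : ℝ) / 2) = |B.det|⁻¹ := by
    rw [hPB, det_mul, det_transpose, neg_div, Real.rpow_neg (mul_self_nonneg _),
      ← Real.sqrt_eq_rpow, Real.sqrt_mul_self_eq_abs]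
  have h4 : ∀ z, g (B *ᵥ z) = |B.det|⁻¹ *
      ((c + (Bᵀ *ᵥ u) ⬝ᵥ z + z ⬝ᵥ ((Bᵀ * K * B) *ᵥ z)) * phiStd z) := by
    intro z
    have e1 : u ⬝ᵥ (B *ᵥ z) = (Bᵀ *ᵥ u) ⬝ᵥ z := by
      rw [dotProduct_mulVec, mulVec_transpose]
    have e2 : (B *ᵥ z) ⬝ᵥ (K *ᵥ (B *ᵥ z)) = z ⬝ᵥ ((Bᵀ * K * B) *ᵥ z) := by
      rw [← mulVec_mulVec, ← mulVec_mulVec, dotProduct_mulVec z, vecMul_transpose]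
    simp only [g]
    rw [quadForm_eq hPB hB, hdet, phi_eq, e1, e2]
    ring
  simp_rw [h4] at h2
  rw [integral_const_mul, quad_val] at h2
  have h5 := mul_left_cancel₀ (inv_pos.mpr hpos).ne' h2
  rw [h1, ← h5, hPB, Matrix.mul_assoc, Matrix.trace_mul_comm, Matrix.mul_assoc]

lemma e_expand {n : ℕ} (Sig : Matrix (Fin n) (Fin n) ℝ) (hSigsymm : Sig.IsSymm)
    (hSigpd : Sig.PosDef) (Psi : Matrix (Fin n) (Fin n) ℝ) (hPsisymm : Psi.IsSymm)
    (a y : Fin n → ℝ) :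
    (1 / 2 : ℝ) * ((a + ((2 : ℝ) • (Sig * Psi)) *ᵥ y) ⬝ᵥ
      (Sig⁻¹ *ᵥ (a + ((2 : ℝ) • (Sig * Psi)) *ᵥ y))) =
    (1 / 2 : ℝ) * (a ⬝ᵥ (Sig⁻¹ *ᵥ a)) + (((2 : ℝ) • Psi) *ᵥ a) ⬝ᵥ y +
      y ⬝ᵥ (((2 : ℝ) • (Psi * Sig * Psi)) *ᵥ y) := by
  have hu : IsUnit Sig.det := isUnit_iff_ne_zero.mpr hSigpd.det_pos.ne'
  have h1 : Sig⁻¹ *ᵥ ((Sig * Psi) *ᵥ y) = Psi *ᵥ y := by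
    rw [mulVec_mulVec, ← Matrix.mul_assoc, Matrix.nonsing_inv_mul _ hu, Matrix.one_mul]
  have hs : ∀ (M : Matrix (Fin n) (Fin n) ℝ), M.IsSymm → ∀ v w : Fin n → ℝ,
      v ⬝ᵥ (M *ᵥ w) = (M *ᵥ v) ⬝ᵥ w := by
    intro M hM v w
    rw [dotProduct_mulVec, ← mulVec_transpose, hM.eq]
  have hinv : Sig⁻¹.IsSymm := by
    rw [IsSymm, transpose_nonsing_inv, hSigsymm.eq]
  have h2 : a ⬝ᵥ (Psi *ᵥ y) = (Psi *ᵥ a) ⬝ᵥ y := hs _ hPsisymm _ _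
  have h3 : ((Sig * Psi) *ᵥ y) ⬝ᵥ (Sig⁻¹ *ᵥ a) = (Psi *ᵥ a) ⬝ᵥ y := by
    rw [hs _ hinv, h1, dotProduct_comm, h2]
  have h4 : ((Sig * Psi) *ᵥ y) ⬝ᵥ (Psi *ᵥ y) = y ⬝ᵥ ((Psi * Sig * Psi) *ᵥ y) := by
    rw [hs _ hPsisymm, mulVec_mulVec, dotProduct_comm, Matrix.mul_assoc]
  simp only [smul_mulVec, mulVec_add, mulVec_smul, dotProduct_add, add_dotProduct, dotProduct_smul,
    smul_dotProduct, smul_eq_mul, h1, h2, h3, h4]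
  ring

lemma full_val {n : ℕ} (Sig : Matrix (Fin n) (Fin n) ℝ) (hSigsymm : Sig.IsSymm)
    (hSigpd : Sig.PosDef) (Psi : Matrix (Fin n) (Fin n) ℝ) (hPsisymm : Psi.IsSymm)
    (lam m0 m : Fin n → ℝ) {P : Matrix (Fin n) (Fin n) ℝ} (hP : P.PosDef) :
    ∫ x : Fin n → ℝ, ((1 / 2 : ℝ) *
              ((Sig *ᵥ lam + ((2 : ℝ) • (Sig * Psi)) *ᵥ (x - m0)) ⬝ᵥ
                (Sig⁻¹ *ᵥ (Sig *ᵥ lam + ((2 : ℝ) • (Sig * Psi)) *ᵥ (x - m0))))) *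
              gaussDensity m P x =
    (1 / 2 : ℝ) * ((Sig *ᵥ lam + ((2 : ℝ) • (Sig * Psi)) *ᵥ (m - m0)) ⬝ᵥ
                (Sig⁻¹ *ᵥ (Sig *ᵥ lam + ((2 : ℝ) • (Sig * Psi)) *ᵥ (m - m0)))) +
      (((2 : ℝ) • (Psi * Sig * Psi)) * P).trace := by
  rw [← gauss_val hP m _
    (((2 : ℝ) • Psi) *ᵥ (Sig *ᵥ lam + ((2 : ℝ) • (Sig * Psi)) *ᵥ (m - m0)))]
  congr 1
  ext x
  congr 1
  rw [← e_expand Sig hSigsymm hSigpd Psi hPsisymm]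
  have : Sig *ᵥ lam + ((2 : ℝ) • (Sig * Psi)) *ᵥ (m - m0) + ((2 : ℝ) • (Sig * Psi)) *ᵥ (x - m) =
      Sig *ᵥ lam + ((2 : ℝ) • (Sig * Psi)) *ᵥ (x - m0) := by
    rw [add_assoc, ← mulVec_add]
    congr 2
    abel
  rw [this]

lemma quad_fderiv {n : ℕ} (K : Matrix (Fin n) (Fin n) ℝ) (m0 : Fin n → ℝ) :
    HasFDerivAt (fun m : Fin n → ℝ => (m - m0) ⬝ᵥ (K *ᵥ (m - m0)))
      (0 : (Fin n → ℝ) →L[ℝ] ℝ) m0 := by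
  have h : ∀ i, HasFDerivAt (fun m : Fin n → ℝ => (m - m0) i * (K *ᵥ (m - m0)) i)
      (0 : (Fin n → ℝ) →L[ℝ] ℝ) m0 := by
    intro i
    have d1 : DifferentiableAt ℝ (fun m : Fin n → ℝ => (m - m0) i) m0 := by
      simp only [Pi.sub_apply]; fun_prop
    have d2 : DifferentiableAt ℝ (fun m : Fin n → ℝ => (K *ᵥ (m - m0)) i) m0 := by
      simp only [mulVec, dotProduct, Pi.sub_apply]; fun_prop
    have := d1.hasFDerivAt.mul d2.hasFDerivAt
    simp only [sub_self, mulVec_zero, Pi.zero_apply, zero_smul, add_zero] at this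
    exact this
  simpa [dotProduct] using HasFDerivAt.fun_sum (u := Finset.univ) fun i _ => h i

/-- For `e(x) = (1/2)(Σλ + 2ΣΨ(x − m₀))ᵀΣ⁻¹(Σλ + 2ΣΨ(x − m₀))`:
(i) the gradient of `m ↦ E_{N(m,P)}[e]` at `m₀` is `2ΨΣλ`;
(ii) the derivative of `P ↦ E_{N(m,P)}[e]` in the direction of a symmetric matrix `D` is
`tr((2ΨΣΨ)·D)`. -/
theorem stmt_11 {n : ℕ} (hn : 1 ≤ n)
    (Sig : Matrix (Fin n) (Fin n) ℝ) (hSigsymm : Sig.IsSymm) (hSigpd : Sig.PosDef)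
    (Psi : Matrix (Fin n) (Fin n) ℝ) (hPsisymm : Psi.IsSymm)
    (lam m0 : Fin n → ℝ) :
    ∀ (P : Matrix (Fin n) (Fin n) ℝ) (hPsymm : P ∈ symmMat n) (hPpd : P.PosDef),
      (∃ L : (Fin n → ℝ) →L[ℝ] ℝ,
        HasFDerivAt
          (fun m : Fin n → ℝ => ∫ x : Fin n → ℝ,
            ((1 / 2 : ℝ) *
              ((Sig *ᵥ lam + ((2 : ℝ) • (Sig * Psi)) *ᵥ (x - m0)) ⬝ᵥ
                (Sig⁻¹ *ᵥ (Sig *ᵥ lam + ((2 : ℝ) • (Sig * Psi)) *ᵥ (x - m0))))) *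
              gaussDensity m P x)
          L m0 ∧
        ∀ h : Fin n → ℝ, L h = (((2 : ℝ) • (Psi * Sig)) *ᵥ lam) ⬝ᵥ h) ∧
      (∀ m : Fin n → ℝ, ∃ L : (symmMat n) →L[ℝ] ℝ,
        HasFDerivAt
          (fun Q : symmMat n => ∫ x : Fin n → ℝ,
            ((1 / 2 : ℝ) *
              ((Sig *ᵥ lam + ((2 : ℝ) • (Sig * Psi)) *ᵥ (x - m0)) ⬝ᵥ
                (Sig⁻¹ *ᵥ (Sig *ᵥ lam + ((2 : ℝ) • (Sig * Psi)) *ᵥ (x - m0))))) *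
              gaussDensity m (Q : Matrix (Fin n) (Fin n) ℝ) x)
          L ⟨P, hPsymm⟩ ∧
        ∀ D : symmMat n,
          L D = (((2 : ℝ) • (Psi * Sig * Psi)) * (D : Matrix (Fin n) (Fin n) ℝ)).trace) := by
  intro P hPsymm hPpd
  refine ⟨?_, fun m => ?_⟩
  · let u : Fin n → ℝ := ((2 : ℝ) • (Psi * Sig)) *ᵥ lam
    let L : (Fin n → ℝ) →L[ℝ] ℝ := LinearMap.toContinuousLinearMap
      { toFun := fun h => u ⬝ᵥ h
        map_add' := fun x y => dotProduct_add _ _ _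
        map_smul' := fun c x => by simp [dotProduct_smul] }
    refine ⟨L, ?_, fun h => rfl⟩
    simp_rw [full_val Sig hSigsymm hSigpd Psi hPsisymm lam m0 _ hPpd,
      e_expand Sig hSigsymm hSigpd Psi hPsisymm]
    have hL : HasFDerivAt (fun m : Fin n → ℝ => L (m - m0)) L m0 :=
      L.hasFDerivAt.comp m0 ((hasFDerivAt_id m0).sub_const m0)
    have hsum := (((hL.const_add ((1 / 2 : ℝ) * ((Sig *ᵥ lam) ⬝ᵥ (Sig⁻¹ *ᵥ (Sig *ᵥ lam))))).add
      (quad_fderiv ((2 : ℝ) • (Psi * Sig * Psi)) m0)).add_const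
      ((((2 : ℝ) • (Psi * Sig * Psi)) * P).trace))
    rw [add_zero] at hsum
    refine hsum.congr_of_eventuallyEq (Filter.Eventually.of_forall fun m => ?_)
    have hu : ((2 : ℝ) • Psi) *ᵥ (Sig *ᵥ lam) = u := by
      simp [u, smul_mulVec, mulVec_mulVec]
    simp only [hu]
    rfl
  · let L : (symmMat n) →L[ℝ] ℝ := LinearMap.toContinuousLinearMap
      { toFun := fun D => (((2 : ℝ) • (Psi * Sig * Psi)) * (D : Matrix (Fin n) (Fin n) ℝ)).trace
        map_add' := fun x y => by simp [Matrix.mul_add]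
        map_smul' := fun c x => by simp }
    refine ⟨L, ?_, fun h => rfl⟩
    have hL := L.hasFDerivAt (x := ⟨P, hPsymm⟩) |>.const_add
      ((1 / 2 : ℝ) * ((Sig *ᵥ lam + ((2 : ℝ) • (Sig * Psi)) *ᵥ (m - m0)) ⬝ᵥ
                (Sig⁻¹ *ᵥ (Sig *ᵥ lam + ((2 : ℝ) • (Sig * Psi)) *ᵥ (m - m0)))))
    refine hL.congr_of_eventuallyEq ?_
    have hev : ∀ᶠ Q : symmMat n in nhds ⟨P, hPsymm⟩,
        (Q : Matrix (Fin n) (Fin n) ℝ).IsSymm → (Q : Matrix (Fin n) (Fin n) ℝ).PosDef :=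
      (continuous_subtype_val.continuousAt (x := (⟨P, hPsymm⟩ : symmMat n))).eventually
        (posDef_ev hPpd)
    filter_upwards [hev] with Q hQ
    exact full_val Sig hSigsymm hSigpd Psi hPsisymm lam m0 m (hQ Q.2)
end
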